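/- arXiv:math/0203105 — 6 statements merged into one kernel-verified Lean document; each statement's English description precedes it below -/
import Mathlib

section
/- Let H ⊆ K_j^+ generate the monoid K_j^+ over ℤ_+, and for each h ∈ H fix an integer h'(h) with (h, h'(h)) ∈ K_{j+1}. Define F := {(h, h'(h)) : h ∈ H} if j ≥ s, and F := {(h, h'(h)) : h ∈ H} ∪ {π_{j+1}(p_{j+1}), −π_{j+1}(p_{j+1})} if j < s. Then F generates K_{j+1}^+ ∪ K_{j+1}^- over ℤ_+, that is, every z ∈ K_{j+1}^+ ∪ K_{j+1}^- can be written as a finite nonnegative-integer combination of elements of F. -/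
/-- Projection of a vector in `ℤ^n` (or `ℝ^n`, etc.) onto its first `j` coordinates. -/
def proj {α : Type*} (n j : ℕ) (h : j ≤ n) (v : Fin n → α) : Fin j → α :=
  fun i => v (Fin.castLE h i)

/-- Projection onto the first `j + 1` coordinates, presented as a pair
    (first `j` coordinates, `(j+1)`-st coordinate). -/
def projPair {α : Type*} (n j : ℕ) (h : j + 1 ≤ n) (v : Fin n → α) : (Fin j → α) × α :=
  (fun i => v (Fin.castLE h i.castSucc), v ⟨j, h⟩)

/-- The lattice `Λ ⊆ ℤ^n` generated by the vectors `p_1, …, p_s`. -/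
def latticeOf {n s : ℕ} (p : Fin s → Fin n → ℤ) : AddSubgroup (Fin n → ℤ) :=
  AddSubgroup.closure (Set.range p)

/-- `K_j := π_j(Λ)`. -/
def KProj (n s j : ℕ) (h : j ≤ n) (p : Fin s → Fin n → ℤ) : Set (Fin j → ℤ) :=
  proj n j h '' (latticeOf p : Set (Fin n → ℤ))

/-- `K_j^+`: the elements of `K_j` with all coordinates nonnegative. -/
def KProjPlus (n s j : ℕ) (h : j ≤ n) (p : Fin s → Fin n → ℤ) : Set (Fin j → ℤ) :=
  {z ∈ KProj n s j h p | ∀ i, 0 ≤ z i}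

/-- `K_{j+1} := π_{j+1}(Λ)`, in pair form. -/
def KPair (n s j : ℕ) (h : j + 1 ≤ n) (p : Fin s → Fin n → ℤ) : Set ((Fin j → ℤ) × ℤ) :=
  projPair n j h '' (latticeOf p : Set (Fin n → ℤ))

/-- `K_{j+1}^+`: first `j` coordinates nonnegative and last coordinate nonnegative. -/
def KPairPlus (n s j : ℕ) (h : j + 1 ≤ n) (p : Fin s → Fin n → ℤ) : Set ((Fin j → ℤ) × ℤ) :=
  {z ∈ KPair n s j h p | (∀ i, 0 ≤ z.1 i) ∧ 0 ≤ z.2}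

/-- `K_{j+1}^-`: first `j` coordinates nonnegative and last coordinate nonpositive. -/
def KPairMinus (n s j : ℕ) (h : j + 1 ≤ n) (p : Fin s → Fin n → ℤ) : Set ((Fin j → ℤ) × ℤ) :=
  {z ∈ KPair n s j h p | (∀ i, 0 ≤ z.1 i) ∧ z.2 ≤ 0}

/-- `z` is a finite nonnegative-integer combination of elements of `F`. -/
def IsNNComb {α : Type*} [AddCommMonoid α] (F : Set α) (z : α) : Prop :=
  ∃ c : α →₀ ℕ, ↑c.support ⊆ F ∧ z = c.sum fun a k => k • a

/-- Being a nonnegative-integer combination of `F` is membership in the additive submonoid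
generated by `F`. -/
theorem isNNComb_iff_mem_closure {α : Type*} [AddCommMonoid α] {F : Set α} {z : α} :
    IsNNComb F z ↔ z ∈ AddSubmonoid.closure F := by
  rw [← Submodule.span_nat_eq_addSubmonoidClosure, Submodule.mem_toAddSubmonoid,
    Submodule.mem_span_set]
  exact exists_congr fun c => and_congr_right fun _ => eq_comm

/-- `projPair` as a homomorphism of additive groups. -/
def projPairHom (n j : ℕ) (h : j + 1 ≤ n) : (Fin n → ℤ) →+ (Fin j → ℤ) × ℤ where
  toFun := projPair n j h
  map_zero' := rfl
  map_add' _ _ := rfl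

/-- Any family of lifts of a generating set generates lifts of all elements. -/
theorem exists_lift_mem_closure {α β : Type*} [AddCommMonoid α] [AddCommMonoid β] {H : Set α}
    (f : α → β) {x : α} (hx : x ∈ AddSubmonoid.closure H) :
    ∃ y ∈ AddSubmonoid.closure ((fun h => (h, f h)) '' H), y.1 = x := by
  have key : (AddSubmonoid.closure ((fun h => (h, f h)) '' H)).map (AddMonoidHom.fst α β) =
      AddSubmonoid.closure H := by
    rw [AddMonoidHom.map_mclosure, Set.image_image]
    simp
  rw [← key] at hx
  exact hx

/-- In the lattice generated by an echelon family, an integer combination whose first `j`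
coordinates vanish has vanishing coefficients on the first `j` generators. -/
theorem echelon_coeff_eq_zero {n s j : ℕ} (hsn : s ≤ n) {p : Fin s → Fin n → ℤ}
    (hech1 : ∀ (i : Fin s) (k : Fin n), (k : ℕ) < (i : ℕ) → p i k = 0)
    (hech2 : ∀ i : Fin s, 0 < p i ⟨(i : ℕ), lt_of_lt_of_le i.isLt hsn⟩)
    {c : Fin s → ℤ} (hc : ∀ k : Fin n, (k : ℕ) < j → ∑ i, c i * p i k = 0)
    (i : Fin s) (hi : (i : ℕ) < j) : c i = 0 := by
  induction i using WellFoundedLT.induction with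
  | ind i ih =>
    have hsum := hc ⟨i, i.isLt.trans_le hsn⟩ hi
    rw [Finset.sum_eq_single i] at hsum
    · exact (mul_eq_zero.mp hsum).resolve_right (hech2 i).ne'
    · intro l _ hl
      rcases lt_or_gt_of_ne hl with h | h
      · rw [ih l h (lt_trans h hi), zero_mul]
      · rw [hech1 l _ h, mul_zero]
    · simp

/-- A lattice vector whose first `j` coordinates vanish agrees, on its first `j + 1` coordinates,
with a multiple of the `j`-th generator (counted from zero), or with zero if there is none. -/
theorem projPair_of_fst_eq_zero {n s j : ℕ} (hsn : s ≤ n) (hjn : j + 1 ≤ n)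
    {p : Fin s → Fin n → ℤ}
    (hech1 : ∀ (i : Fin s) (k : Fin n), (k : ℕ) < (i : ℕ) → p i k = 0)
    (hech2 : ∀ i : Fin s, 0 < p i ⟨(i : ℕ), lt_of_lt_of_le i.isLt hsn⟩)
    {v : Fin n → ℤ} (hv : v ∈ latticeOf p) (hv0 : (projPair n j hjn v).1 = 0) :
    (s ≤ j → projPair n j hjn v = 0) ∧
      ∀ hjs : j < s, ∃ m : ℤ, projPair n j hjn v = m • projPair n j hjn (p ⟨j, hjs⟩) := by
  rw [latticeOf, ← Submodule.span_int_eq_addSubgroupClosure, Submodule.mem_toAddSubgroup,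
    Submodule.mem_span_range_iff_exists_fun] at hv
  obtain ⟨c, rfl⟩ := hv
  have hc : ∀ i : Fin s, (i : ℕ) < j → c i = 0 := by
    refine echelon_coeff_eq_zero hsn hech1 hech2 fun k hk => ?_
    simpa [projPair] using congrFun hv0 ⟨k, hk⟩
  constructor
  · intro hsj
    have : ∑ i, c i • p i = 0 :=
      Finset.sum_eq_zero fun i _ => by rw [hc i (i.isLt.trans_le hsj), zero_smul]
    rw [this]
    rfl
  · intro hjs
    refine ⟨c ⟨j, hjs⟩, Prod.ext ?_ ?_⟩
    · rw [hv0]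
      ext k
      have hk : p ⟨j, hjs⟩ (Fin.castLE hjn k.castSucc) = 0 := hech1 ⟨j, hjs⟩ _ k.isLt
      simp only [projPair, Prod.smul_fst, Pi.smul_apply, hk, smul_zero, Pi.zero_apply]
    · simp only [projPair, Finset.sum_apply, Pi.smul_apply, Prod.smul_snd]
      refine Finset.sum_eq_single _ (fun l _ hl => ?_) (by simp)
      rcases lt_or_gt_of_ne hl with h | h
      · rw [hc l h, zero_smul]
      · rw [hech1 l _ h, smul_zero]

/-- An additive submonoid containing `x` and `-x` contains all integer multiples of `x`. -/
theorem AddSubmonoid.zsmul_mem_of_neg_mem {α : Type*} [AddGroup α] {M : AddSubmonoid α} {x : α}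
    (hx : x ∈ M) (hx' : -x ∈ M) (m : ℤ) : m • x ∈ M := by
  cases m with
  | ofNat k => simpa using M.nsmul_mem hx k
  | negSucc k =>
    rw [negSucc_zsmul, ← neg_nsmul]
    exact M.nsmul_mem hx' _

/-- Lemma 2.2: if `H` generates the monoid `K_j^+` over `ℤ_+`, and for each `h ∈ H` we fix a
lift `(h, h'(h)) ∈ K_{j+1}`, then `F` (as defined by cases on `j ≥ s` vs `j < s`) generates
`K_{j+1}^+ ∪ K_{j+1}^-` over `ℤ_+`. -/
theorem stmt0 (n s j : ℕ) (hs : 1 ≤ s) (hsn : s ≤ n) (hj : 1 ≤ j) (hjn : j + 1 ≤ n)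
    (p : Fin s → Fin n → ℤ)
    (hech1 : ∀ (i : Fin s) (k : Fin n), (k : ℕ) < (i : ℕ) → p i k = 0)
    (hech2 : ∀ i : Fin s, 0 < p i ⟨(i : ℕ), lt_of_lt_of_le i.isLt hsn⟩)
    (H : Set (Fin j → ℤ))
    (hHsub : H ⊆ KProjPlus n s j (Nat.le_of_succ_le hjn) p)
    (hHgen : ∀ z ∈ KProjPlus n s j (Nat.le_of_succ_le hjn) p, IsNNComb H z)
    (h' : (Fin j → ℤ) → ℤ)
    (hh' : ∀ h ∈ H, (h, h' h) ∈ KPair n s j hjn p)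
    (F : Set ((Fin j → ℤ) × ℤ))
    (hF1 : s ≤ j → F = (fun h => (h, h' h)) '' H)
    (hF2 : ∀ hjs : j < s,
      F = (fun h => (h, h' h)) '' H ∪
          {projPair n j hjn (p ⟨j, hjs⟩), -projPair n j hjn (p ⟨j, hjs⟩)}) :
    ∀ z ∈ KPairPlus n s j hjn p ∪ KPairMinus n s j hjn p, IsNNComb F z := by
  intro z hz
  obtain ⟨hzK, hznn⟩ : z ∈ KPair n s j hjn p ∧ ∀ i, 0 ≤ z.1 i := by
    rcases hz with hz | hz <;> exact ⟨hz.1, hz.2.1⟩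
  rw [isNNComb_iff_mem_closure]
  have hz1 : z.1 ∈ KProjPlus n s j (Nat.le_of_succ_le hjn) p := by
    refine ⟨?_, hznn⟩
    obtain ⟨v, hv, rfl⟩ := hzK
    exact ⟨v, hv, rfl⟩
  obtain ⟨y, hy, hyz⟩ :=
    exists_lift_mem_closure h' (isNNComb_iff_mem_closure.mp (hHgen _ hz1))
  have hHF : (fun h => (h, h' h)) '' H ⊆ F := by
    rcases le_or_gt s j with hsj | hjs
    · rw [hF1 hsj]
    · rw [hF2 hjs]
      exact Set.subset_union_left
  have hyF : y ∈ AddSubmonoid.closure F := AddSubmonoid.closure_mono hHF hy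
  have hyK : y ∈ (latticeOf p).map (projPairHom n j hjn) := by
    refine (AddSubmonoid.closure_le (S := ((latticeOf p).map
      (projPairHom n j hjn)).toAddSubmonoid)).mpr ?_ hy
    rintro _ ⟨h, hh, rfl⟩
    exact hh' h hh
  obtain ⟨v, hv, hvzy⟩ := AddSubgroup.sub_mem _ (show z ∈ (latticeOf p).map
    (projPairHom n j hjn) from hzK) hyK
  replace hvzy : projPair n j hjn v = z - y := hvzy
  have hv0 : (projPair n j hjn v).1 = 0 := by rw [hvzy, Prod.fst_sub, hyz, sub_self]
  obtain ⟨hle, hlt⟩ := projPair_of_fst_eq_zero hsn hjn hech1 hech2 hv hv0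
  rw [← sub_add_cancel z y, ← hvzy]
  refine AddSubmonoid.add_mem _ ?_ hyF
  rcases le_or_gt s j with hsj | hjs
  · rw [hle hsj]
    exact AddSubmonoid.zero_mem _
  · obtain ⟨m, hm⟩ := hlt hjs
    rw [hm]
    apply AddSubmonoid.zsmul_mem_of_neg_mem <;> apply AddSubmonoid.subset_closure <;>
      rw [hF2 hjs] <;> simp
end

section
/- Suppose G ⊆ K_{j+1}^+ ∪ K_{j+1}^- satisfies: (i) every element of K_{j+1}^+ ∪ K_{j+1}^- is a finite nonnegative-integer combination of elements of G; and (ii) for all (v, v'), (w, w') ∈ G with v'·w' < 0, the sum (v + w, v' + w') can be written as a finite nonnegative-integer combination Σ_k β_k (w_k, w'_k) with all (w_k, w'_k) ∈ G and (w_k, w'_k) ⊑_{j+1} (v + w, v' + w'). Then G contains every irreducible element of K_{j+1}^+ and every irreducible element of K_{j+1}^-, i.e., H_{j+1}^+ ∪ H_{j+1}^- ⊆ G. -/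
/-- The partial order `u ⊑_{j+1} v`. -/
def sqle {j : ℕ} (u v : (Fin j → ℤ) × ℤ) : Prop :=
  (∀ i, u.1 i ≤ v.1 i) ∧ |u.2| ≤ |v.2| ∧ 0 ≤ u.2 * v.2

/-- `z` is a finite nonnegative-integer combination of elements of `F`, all of which
satisfy the predicate `P` (the coefficients on the support are automatically positive). -/
def IsNNCombP {α : Type*} [AddCommMonoid α] (F : Set α) (P : α → Prop) (z : α) : Prop :=
  ∃ c : α →₀ ℕ, ↑c.support ⊆ F ∧ (∀ a ∈ c.support, P a) ∧ z = c.sum fun a k => k • a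

/-- `z` is an irreducible element of (the monoid) `S`: it is a nonzero element of `S`
that is not the sum of two nonzero elements of `S`. -/
def IsIrred {α : Type*} [AddCommMonoid α] (S : Set α) (z : α) : Prop :=
  z ∈ S ∧ z ≠ 0 ∧ ∀ x ∈ S, ∀ y ∈ S, x ≠ 0 → y ≠ 0 → z ≠ x + y

/-- A nonnegative-integer combination is the sum of a multiset. -/
theorem IsNNCombP.exists_multiset {α : Type*} [AddCommMonoid α] {F : Set α} {P : α → Prop} {z : α}
    (h : IsNNCombP F P z) : ∃ m : Multiset α, (∀ a ∈ m, a ∈ F ∧ P a) ∧ m.sum = z := by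
  obtain ⟨c, hF, hP, rfl⟩ := h
  refine ⟨∑ a ∈ c.support, Multiset.replicate (c a) a, fun a ha => ?_, ?_⟩
  · obtain ⟨b, hb, hab⟩ := Multiset.mem_sum.1 ha
    obtain rfl := Multiset.eq_of_mem_replicate hab
    exact ⟨hF hb, hP a hb⟩
  · change Multiset.sumAddMonoidHom _ = _
    simp [map_sum, Finsupp.sum]

theorem IsNNComb.exists_multiset {α : Type*} [AddCommMonoid α] {F : Set α} {z : α}
    (h : IsNNComb F z) : ∃ m : Multiset α, (∀ a ∈ m, a ∈ F) ∧ m.sum = z := by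
  obtain ⟨c, hF, hc⟩ := h
  obtain ⟨m, hm, hz⟩ := IsNNCombP.exists_multiset (P := fun _ => True) ⟨c, hF, by simp, hc⟩
  exact ⟨m, fun a ha => (hm a ha).1, hz⟩

/-- An irreducible element occurs in each of its decompositions. -/
theorem IsIrred.mem_of_sum_eq {α : Type*} [AddCommMonoid α] {S : AddSubmonoid α} {z : α}
    (hz : IsIrred (S : Set α) z) {m : Multiset α} (hm : ∀ a ∈ m, a ∈ S) (hsum : m.sum = z) :
    z ∈ m := by
  induction m using Multiset.induction with
  | empty => exact absurd hsum.symm hz.2.1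
  | cons a m ih =>
    rw [Multiset.sum_cons] at hsum
    have hm' : ∀ b ∈ m, b ∈ S := fun b hb => hm b (Multiset.mem_cons_of_mem hb)
    by_cases ha : a = 0
    · rw [ha, zero_add] at hsum
      exact Multiset.mem_cons_of_mem (ih hm' hsum)
    by_cases h0 : m.sum = 0
    · rw [h0, add_zero] at hsum
      simp [hsum]
    · exact absurd hsum.symm (hz.2.2 a (hm a (Multiset.mem_cons_self a m)) _
        (S.multiset_sum_mem m hm') ha h0)

/-- If elements `⊑ v` add up to `v`, then the absolute values of their last coordinates add up to
`|v.2|`. -/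
theorem sum_natAbs_of_sqle {j : ℕ} {v : (Fin j → ℤ) × ℤ} {m : Multiset ((Fin j → ℤ) × ℤ)}
    (hm : ∀ a ∈ m, sqle a v) (hsum : m.sum = v) :
    (m.map fun a => a.2.natAbs).sum = v.2.natAbs := by
  have key : ∀ m : Multiset ((Fin j → ℤ) × ℤ),
      ((∀ a ∈ m, 0 ≤ a.2) ∨ ∀ a ∈ m, a.2 ≤ 0) →
      (m.map fun a => a.2.natAbs).sum = m.sum.2.natAbs ∧
      ((∀ a ∈ m, 0 ≤ a.2) → 0 ≤ m.sum.2) ∧ ((∀ a ∈ m, a.2 ≤ 0) → m.sum.2 ≤ 0) := by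
    intro m
    induction m using Multiset.induction with
    | empty => simp
    | cons a m ih =>
      simp only [Multiset.mem_cons, forall_eq_or_imp, Multiset.map_cons, Multiset.sum_cons,
        Prod.snd_add]
      grind
  rw [← hsum]
  refine (key m ?_).1
  rcases lt_trichotomy v.2 0 with h | h | h
  · exact Or.inr fun a ha => by nlinarith [(hm a ha).2.2]
  · refine Or.inr fun a ha => ?_
    have h1 := (hm a ha).2.1
    rw [h, abs_zero] at h1
    exact (abs_nonpos_iff.1 h1).le
  · exact Or.inl fun a ha => by nlinarith [(hm a ha).2.2]

/-- If sums of elements of `G` of opposite sign reduce to `0`, every sum of elements of `G` can be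
rewritten without cancellation in the last coordinate. -/
theorem exists_sum_eq_of_same_sign {j : ℕ} {G : Set ((Fin j → ℤ) × ℤ)}
    (hS : ∀ v ∈ G, ∀ w ∈ G, v.2 * w.2 < 0 → IsNNCombP G (fun a => sqle a (v + w)) (v + w))
    (m : Multiset ((Fin j → ℤ) × ℤ)) (hm : ∀ a ∈ m, a ∈ G) :
    ∃ m' : Multiset ((Fin j → ℤ) × ℤ), (∀ a ∈ m', a ∈ G) ∧ m'.sum = m.sum ∧
      ∀ a ∈ m', ∀ b ∈ m', 0 ≤ a.2 * b.2 := by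
  induction h : (m.map fun a => a.2.natAbs).sum using Nat.strong_induction_on generalizing m with
  | _ N ih =>
    by_cases hsign : ∀ a ∈ m, ∀ b ∈ m, 0 ≤ a.2 * b.2
    · exact ⟨m, hm, rfl, hsign⟩
    push Not at hsign
    obtain ⟨a, ha, b, hb, hab⟩ := hsign
    obtain ⟨t, rfl⟩ := Multiset.exists_cons_of_mem ha
    have hb' : b ∈ t := by
      rcases Multiset.mem_cons.1 hb with rfl | h'
      · exact absurd hab (not_lt.2 (mul_self_nonneg _))
      · exact h'
    obtain ⟨u, rfl⟩ := Multiset.exists_cons_of_mem hb'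
    obtain ⟨r, hr, hrsum⟩ := (hS a (hm a ha) b (hm b hb) hab).exists_multiset
    have hlen := sum_natAbs_of_sqle (fun c hc => (hr c hc).2) hrsum
    obtain ⟨m', hm', hsum, hsign⟩ := ih _ (by
        simp only [← h, Multiset.map_add, Multiset.map_cons, Multiset.sum_add, Multiset.sum_cons,
          hlen, Prod.snd_add]
        rcases mul_neg_iff.1 hab with h' | h' <;> omega) (r + u) (by
        intro c hc
        rcases Multiset.mem_add.1 hc with hc | hc
        · exact (hr c hc).1
        · exact hm c (by simp [hc])) rfl
    exact ⟨m', hm', by rw [hsum, Multiset.sum_add, hrsum, Multiset.sum_cons, Multiset.sum_cons,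
      add_assoc], hsign⟩

/-- In a multiset without cancellation in the last coordinate, `a.2 ^ 2 ≤ a.2 * (∑ b).2`. -/
theorem sq_snd_le_mul_sum {j : ℕ} {m : Multiset ((Fin j → ℤ) × ℤ)}
    (hm : ∀ a ∈ m, ∀ b ∈ m, 0 ≤ a.2 * b.2) {a : (Fin j → ℤ) × ℤ} (ha : a ∈ m) :
    a.2 * a.2 ≤ a.2 * m.sum.2 := by
  obtain ⟨t, rfl⟩ := Multiset.exists_cons_of_mem ha
  have ht : 0 ≤ a.2 * t.sum.2 := by
    change 0 ≤ ((AddMonoidHom.mulLeft a.2).comp (AddMonoidHom.snd _ _)) t.sum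
    rw [map_multiset_sum]
    refine Multiset.sum_nonneg fun x hx => ?_
    obtain ⟨b, hb, rfl⟩ := Multiset.mem_map.1 hx
    exact hm a ha b (Multiset.mem_cons_of_mem hb)
  rw [Multiset.sum_cons, Prod.snd_add, mul_add]
  linarith

theorem KPair_zero_mem (n s j : ℕ) (h : j + 1 ≤ n) (p : Fin s → Fin n → ℤ) :
    0 ∈ KPair n s j h p :=
  ⟨0, (latticeOf p).zero_mem, rfl⟩

theorem KPair_add_mem {n s j : ℕ} {h : j + 1 ≤ n} {p : Fin s → Fin n → ℤ}
    {x y : (Fin j → ℤ) × ℤ} (hx : x ∈ KPair n s j h p) (hy : y ∈ KPair n s j h p) :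
    x + y ∈ KPair n s j h p := by
  obtain ⟨x', hx', rfl⟩ := hx
  obtain ⟨y', hy', rfl⟩ := hy
  exact ⟨x' + y', (latticeOf p).add_mem hx' hy', rfl⟩

/-- `K_{j+1}^+` as a monoid. -/
def KPairPlusSubmonoid (n s j : ℕ) (h : j + 1 ≤ n) (p : Fin s → Fin n → ℤ) :
    AddSubmonoid ((Fin j → ℤ) × ℤ) where
  carrier := KPairPlus n s j h p
  zero_mem' := ⟨KPair_zero_mem n s j h p, fun _ => le_rfl, le_rfl⟩
  add_mem' hx hy := ⟨KPair_add_mem hx.1 hy.1, fun i => add_nonneg (hx.2.1 i) (hy.2.1 i),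
    add_nonneg hx.2.2 hy.2.2⟩

/-- `K_{j+1}^-` as a monoid. -/
def KPairMinusSubmonoid (n s j : ℕ) (h : j + 1 ≤ n) (p : Fin s → Fin n → ℤ) :
    AddSubmonoid ((Fin j → ℤ) × ℤ) where
  carrier := KPairMinus n s j h p
  zero_mem' := ⟨KPair_zero_mem n s j h p, fun _ => le_rfl, le_rfl⟩
  add_mem' hx hy := ⟨KPair_add_mem hx.1 hy.1, fun i => add_nonneg (hx.2.1 i) (hy.2.1 i),
    add_nonpos hx.2.2 hy.2.2⟩

/-- Correctness of the completion procedure (part of Lemma 2.5): if `G ⊆ K_{j+1}^+ ∪ K_{j+1}^-`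
generates `K_{j+1}^+ ∪ K_{j+1}^-` over `ℤ_+`, and every S-vector of two elements of `G` reduces
to `0` with respect to `G` (i.e. is a nonnegative-integer combination of elements of `G` that are
`⊑_{j+1}` it), then `G` contains all irreducible elements of `K_{j+1}^+` and of `K_{j+1}^-`. -/
theorem stmt1 (n s j : ℕ) (hs : 1 ≤ s) (hsn : s ≤ n) (hj : 1 ≤ j) (hjn : j + 1 ≤ n)
    (p : Fin s → Fin n → ℤ)
    (hech1 : ∀ (i : Fin s) (k : Fin n), (k : ℕ) < (i : ℕ) → p i k = 0)
    (hech2 : ∀ i : Fin s, 0 < p i ⟨(i : ℕ), lt_of_lt_of_le i.isLt hsn⟩)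
    (G : Set ((Fin j → ℤ) × ℤ))
    (hGsub : G ⊆ KPairPlus n s j hjn p ∪ KPairMinus n s j hjn p)
    (hGgen : ∀ z ∈ KPairPlus n s j hjn p ∪ KPairMinus n s j hjn p, IsNNComb G z)
    (hS : ∀ v ∈ G, ∀ w ∈ G, v.2 * w.2 < 0 →
      IsNNCombP G (fun a => sqle a (v + w)) (v + w)) :
    ∀ z : (Fin j → ℤ) × ℤ,
      (IsIrred (KPairPlus n s j hjn p) z ∨ IsIrred (KPairMinus n s j hjn p) z) → z ∈ G := by
  intro z hz
  have hzK : z ∈ KPairPlus n s j hjn p ∪ KPairMinus n s j hjn p := hz.imp And.left And.left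
  obtain ⟨m₀, hm₀, hsum₀⟩ := (hGgen z hzK).exists_multiset
  obtain ⟨m, hmG, hsum, hsign⟩ := exists_sum_eq_of_same_sign hS m₀ hm₀
  rw [hsum₀] at hsum
  have hmK : ∀ a ∈ m, a ∈ KPair n s j hjn p ∧ ∀ i, 0 ≤ a.1 i := fun a ha =>
    (hGsub (hmG a ha)).elim (fun h => ⟨h.1, h.2.1⟩) fun h => ⟨h.1, h.2.1⟩
  have hsq : ∀ a ∈ m, a.2 * a.2 ≤ a.2 * z.2 := fun a ha => hsum ▸ sq_snd_le_mul_sum hsign ha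
  refine hmG z ?_
  rcases hz with hz | hz
  · refine IsIrred.mem_of_sum_eq (S := KPairPlusSubmonoid n s j hjn p) hz (fun a ha => ?_) hsum
    exact ⟨(hmK a ha).1, (hmK a ha).2, by nlinarith [hsq a ha, hz.1.2.2]⟩
  · refine IsIrred.mem_of_sum_eq (S := KPairMinusSubmonoid n s j hjn p) hz (fun a ha => ?_) hsum
    exact ⟨(hmK a ha).1, (hmK a ha).2, by nlinarith [hsq a ha, hz.1.2.2]⟩
end

section
/- Let k ≥ 1 and let (z, z') ∈ K_{j+1}^+ ∪ K_{j+1}^- with ‖z‖_1 = k + 1; if j < s assume moreover |z'| < p_{j+1}^{(j+1)}. Then exactly one of the following holds: (1) there exists (v, v') ∈ 𝒢_{≤k} with (v, v') ⊑_{j+1} (z, z'), and in this case (z, z') is a finite positive-integer combination of elements of 𝒢_{≤k} each of which is ⊑_{j+1} (z, z'); or (2) no such (v, v') ∈ 𝒢_{≤k} exists, and in this case (z, z') ∈ 𝒢_{k+1}, i.e., (z, z') is irreducible. -/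
namespace IsNNCombP

variable {α : Type*} [AddCommMonoid α] {F G : Set α} {P Q : α → Prop} {x y : α}

theorem zero (F : Set α) (P : α → Prop) : IsNNCombP F P 0 :=
  ⟨0, by simp, by simp, by simp⟩

theorem of_mem (hx : x ∈ F) (hP : P x) : IsNNCombP F P x := by
  classical
  refine ⟨Finsupp.single x 1, fun a ha => ?_, fun a ha => ?_, by simp⟩
  · have := Finset.mem_singleton.1 (Finsupp.support_single_subset ha)
    exact this ▸ hx
  · have := Finset.mem_singleton.1 (Finsupp.support_single_subset ha)
    exact this ▸ hP

theorem add (hx : IsNNCombP F P x) (hy : IsNNCombP F P y) : IsNNCombP F P (x + y) := by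
  classical
  obtain ⟨c, hcF, hcP, rfl⟩ := hx
  obtain ⟨d, hdF, hdP, rfl⟩ := hy
  refine ⟨c + d, fun a ha => ?_, fun a ha => ?_, ?_⟩
  · exact (Finset.mem_union.1 (Finsupp.support_add ha)).elim (fun h => hcF h) (fun h => hdF h)
  · exact (Finset.mem_union.1 (Finsupp.support_add ha)).elim (hcP a) (hdP a)
  · exact (Finsupp.sum_add_index' (by simp) (fun a m n => add_nsmul a m n)).symm

theorem mono (hx : IsNNCombP F P x) (h : ∀ a ∈ F, P a → a ∈ G ∧ Q a) : IsNNCombP G Q x := by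
  obtain ⟨c, hF, hP, hc⟩ := hx
  exact ⟨c, fun a ha => (h a (hF ha) (hP a ha)).1, fun a ha => (h a (hF ha) (hP a ha)).2, hc⟩

theorem exists_of_ne_zero (hx : IsNNCombP F P x) (h0 : x ≠ 0) : ∃ a ∈ F, P a := by
  obtain ⟨c, hF, hP, rfl⟩ := hx
  obtain ⟨a, ha⟩ : c.support.Nonempty := by
    rw [Finset.nonempty_iff_ne_empty]
    intro hc
    exact h0 (by simp [Finsupp.sum, hc])
  exact ⟨a, hF ha, hP a ha⟩

end IsNNCombP

theorem sqle.refl {j : ℕ} (u : (Fin j → ℤ) × ℤ) : sqle u u :=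
  ⟨fun _ => le_rfl, le_rfl, mul_self_nonneg _⟩

theorem sqle.trans {j : ℕ} {u v w : (Fin j → ℤ) × ℤ} (huv : sqle u v) (hvw : sqle v w) :
    sqle u w := by
  refine ⟨fun i => (huv.1 i).trans (hvw.1 i), huv.2.1.trans hvw.2.1, ?_⟩
  obtain ⟨-, h1, h2⟩ := huv
  obtain ⟨-, -, h4⟩ := hvw
  rcases lt_trichotomy v.2 0 with h | h | h
  · exact mul_nonneg_of_nonpos_of_nonpos (by nlinarith) (by nlinarith)
  · rw [h, abs_zero, abs_nonpos_iff] at h1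
    simp [h1]
  · exact mul_nonneg (by nlinarith) (by nlinarith)

theorem sqle.sum_le {j : ℕ} {u v : (Fin j → ℤ) × ℤ} (h : sqle u v) :
    ∑ i, u.1 i ≤ ∑ i, v.1 i :=
  Finset.sum_le_sum fun i _ => h.1 i

/-- The elements of `A` whose first `j` coordinates are nonnegative and whose last coordinate
is nonnegative after multiplication by `σ`. -/
def signedCone {j : ℕ} (A : AddSubgroup ((Fin j → ℤ) × ℤ)) (σ : ℤ) : Set ((Fin j → ℤ) × ℤ) :=
  {z | z ∈ A ∧ (∀ i, 0 ≤ z.1 i) ∧ 0 ≤ σ * z.2}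

section signedCone

variable {j : ℕ} {A : AddSubgroup ((Fin j → ℤ) × ℤ)} {σ : ℤ} {x y z v : (Fin j → ℤ) × ℤ}

theorem sum_nonneg_of_mem_signedCone (hx : x ∈ signedCone A σ) : 0 ≤ ∑ i, x.1 i :=
  Finset.sum_nonneg fun i _ => hx.2.1 i

theorem fst_eq_zero_of_mem_signedCone (hx : x ∈ signedCone A σ) (h : ∑ i, x.1 i ≤ 0) :
    x.1 = 0 := by
  have h0 := (Finset.sum_eq_zero_iff_of_nonneg fun i _ => hx.2.1 i).1
    (le_antisymm h (sum_nonneg_of_mem_signedCone hx))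
  exact funext fun i => h0 i (Finset.mem_univ i)

theorem sqle_add (hσ : σ = 1 ∨ σ = -1) (hx : x ∈ signedCone A σ) (hy : y ∈ signedCone A σ) :
    sqle x (x + y) := by
  obtain ⟨-, hx1, hx2⟩ := hx
  obtain ⟨-, hy1, hy2⟩ := hy
  refine ⟨fun i => by simpa using hy1 i, ?_, ?_⟩
  · rcases hσ with rfl | rfl
    · exact abs_le_abs_of_nonneg (by linarith) (by simp only [Prod.snd_add]; linarith)
    · exact abs_le_abs_of_nonpos (by linarith) (by simp only [Prod.snd_add]; linarith)
  · rcases hσ with rfl | rfl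
    · exact mul_nonneg (by linarith) (by simp only [Prod.snd_add]; linarith)
    · exact mul_nonneg_of_nonpos_of_nonpos (by linarith) (by simp only [Prod.snd_add]; linarith)

theorem mem_signedCone_and_sub_mem (hσ : σ = 1 ∨ σ = -1) (hz : z ∈ signedCone A σ) (hv : v ∈ A)
    (hv0 : ∀ i, 0 ≤ v.1 i) (h : sqle v z) : v ∈ signedCone A σ ∧ z - v ∈ signedCone A σ := by
  obtain ⟨hzA, -, hz2⟩ := hz
  obtain ⟨h1, h2, h3⟩ := h
  have key : 0 ≤ σ * v.2 ∧ 0 ≤ σ * (z.2 - v.2) := by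
    rcases eq_or_ne z.2 0 with h0 | h0
    · rw [h0, abs_zero, abs_nonpos_iff] at h2
      simp [h0, h2]
    rcases hσ with rfl | rfl
    · have hz' : 0 < z.2 := lt_of_le_of_ne (by linarith) h0.symm
      have hv' : 0 ≤ v.2 := nonneg_of_mul_nonneg_left h3 hz'
      rw [abs_of_nonneg hv', abs_of_pos hz'] at h2
      constructor <;> linarith
    · have hz' : z.2 < 0 := lt_of_le_of_ne (by linarith) h0
      have hv' : v.2 ≤ 0 := by nlinarith
      rw [abs_of_nonpos hv', abs_of_neg hz'] at h2
      constructor <;> linarith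
  exact ⟨⟨hv, hv0, key.1⟩, A.sub_mem hzA hv, fun i => by simpa using h1 i, key.2⟩

/-- Every element of a signed cone is a sum of irreducible elements lying below it. -/
theorem isNNCombP_irred (hσ : σ = 1 ∨ σ = -1) (hz : z ∈ signedCone A σ) :
    IsNNCombP {g | IsIrred (signedCone A σ) g} (fun g => sqle g z) z := by
  obtain ⟨N, hN⟩ : ∃ N : ℕ, (∑ i, z.1 i) + σ * z.2 ≤ N := ⟨_, Int.self_le_toNat _⟩
  induction N using Nat.strong_induction_on generalizing z with
  | _ N ih =>
    by_cases h0 : z = 0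
    · exact h0 ▸ IsNNCombP.zero _ _
    by_cases hirr : IsIrred (signedCone A σ) z
    · exact IsNNCombP.of_mem hirr (sqle.refl z)
    obtain ⟨x, hx, y, hy, hx0, hy0, rfl⟩ :
        ∃ x ∈ signedCone A σ, ∃ y ∈ signedCone A σ, x ≠ 0 ∧ y ≠ 0 ∧ z = x + y := by
      by_contra! hcon
      exact hirr ⟨hz, h0, hcon⟩
    have pos : ∀ w ∈ signedCone A σ, w ≠ 0 → 0 < (∑ i, w.1 i) + σ * w.2 := by
      intro w hw hw0
      by_contra! hle
      have hs := sum_nonneg_of_mem_signedCone hw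
      have hw1 := fst_eq_zero_of_mem_signedCone hw (by linarith [hw.2.2])
      have hw2 : σ * w.2 = 0 := by linarith [hw.2.2]
      have hw2' : w.2 = 0 := by rcases hσ with rfl | rfl <;> simpa using hw2
      exact hw0 (Prod.ext hw1 hw2')
    have hpx := pos x hx hx0
    have hpy := pos y hy hy0
    have hsum : (∑ i, (x + y).1 i) + σ * (x + y).2 =
        ((∑ i, x.1 i) + σ * x.2) + ((∑ i, y.1 i) + σ * y.2) := by
      simp only [Prod.fst_add, Prod.snd_add, Pi.add_apply, Finset.sum_add_distrib]
      ring
    have hcx := ih (N - 1) (by omega) hx (by omega)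
    have hcy := ih (N - 1) (by omega) hy (by omega)
    exact (hcx.mono fun a ha h => ⟨ha, h.trans (sqle_add hσ hx hy)⟩).add
      (hcy.mono fun a ha h => ⟨ha, h.trans (add_comm y x ▸ sqle_add hσ hy hx)⟩)

theorem sum_pos_of_mem_signedCone
    (hA : ∀ w ∈ A, w.1 = 0 → |w.2| ≤ |z.2| → w.2 = 0)
    (hx : x ∈ signedCone A σ) (hx0 : x ≠ 0) (hxz : sqle x z) : 0 < ∑ i, x.1 i := by
  by_contra! h
  have h1 := fst_eq_zero_of_mem_signedCone hx h
  exact hx0 (Prod.ext h1 (hA x hx.1 h1 hxz.2.1))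

/-- An element of norm `k + 1` lying above an irreducible element of norm at most `k` is a sum of
irreducible elements of norm at most `k`. -/
theorem isNNCombP_of_sqle (hσ : σ = 1 ∨ σ = -1)
    (hA : ∀ w ∈ A, w.1 = 0 → |w.2| ≤ |z.2| → w.2 = 0) {k : ℤ} (hz : z ∈ signedCone A σ)
    (hk : ∑ i, z.1 i = k + 1) (hv : v ∈ A) (hv0 : ∀ i, 0 ≤ v.1 i) (hne : v ≠ 0)
    (hvk : ∑ i, v.1 i ≤ k) (h : sqle v z) :
    IsNNCombP {g | IsIrred (signedCone A σ) g ∧ ∑ i, g.1 i ≤ k} (fun g => sqle g z) z := by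
  obtain ⟨hvS, hzv⟩ := mem_signedCone_and_sub_mem hσ hz hv hv0 h
  have hpos := sum_pos_of_mem_signedCone hA hvS hne h
  have hle : sqle (z - v) z := by simpa using sqle_add hσ hzv hvS
  have hsum : ∑ i, (z - v).1 i = ∑ i, z.1 i - ∑ i, v.1 i := by
    simp [Finset.sum_sub_distrib]
  have h1 := (isNNCombP_irred hσ hvS).mono (G := {g | IsIrred (signedCone A σ) g ∧ ∑ i, g.1 i ≤ k})
    (Q := fun g => sqle g z) fun a ha hav => ⟨⟨ha, hav.sum_le.trans hvk⟩, hav.trans h⟩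
  have h2 := (isNNCombP_irred hσ hzv).mono (G := {g | IsIrred (signedCone A σ) g ∧ ∑ i, g.1 i ≤ k})
    (Q := fun g => sqle g z) fun a ha hav =>
      ⟨⟨ha, hav.sum_le.trans (by linarith)⟩, hav.trans hle⟩
  simpa using h1.add h2

/-- An element of norm `k + 1` not lying above any irreducible element of norm at most `k` is
irreducible. -/
theorem isIrred_of_not_sqle (hσ : σ = 1 ∨ σ = -1)
    (hA : ∀ w ∈ A, w.1 = 0 → |w.2| ≤ |z.2| → w.2 = 0) {k : ℤ} (hz : z ∈ signedCone A σ)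
    (hz0 : z ≠ 0) (hk : ∑ i, z.1 i = k + 1)
    (h : ¬ ∃ g, IsIrred (signedCone A σ) g ∧ ∑ i, g.1 i ≤ k ∧ sqle g z) :
    IsIrred (signedCone A σ) z := by
  refine ⟨hz, hz0, ?_⟩
  rintro x hx y hy hx0 hy0 rfl
  have hxz := sqle_add hσ hx hy
  have hyz : sqle y (x + y) := add_comm y x ▸ sqle_add hσ hy hx
  have hpos := sum_pos_of_mem_signedCone hA hy hy0 hyz
  have hsum : ∑ i, (x + y).1 i = ∑ i, x.1 i + ∑ i, y.1 i := by
    simp [Finset.sum_add_distrib]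
  obtain ⟨g, hg, hgx⟩ := (isNNCombP_irred hσ hx).exists_of_ne_zero hx0
  exact h ⟨g, hg, hgx.sum_le.trans (by linarith), hgx.trans hxz⟩

end signedCone

/-- A lattice vector of an echelon basis whose coordinates before `j` vanish has `j`-th coordinate
a multiple of the `j`-th pivot. -/
theorem echelon_apply_of_forall_lt {n s : ℕ} (hsn : s ≤ n) {p : Fin s → Fin n → ℤ}
    (hech1 : ∀ (i : Fin s) (k : Fin n), (k : ℕ) < (i : ℕ) → p i k = 0)
    (hech2 : ∀ i : Fin s, 0 < p i ⟨(i : ℕ), lt_of_lt_of_le i.isLt hsn⟩)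
    {u : Fin n → ℤ} (hu : u ∈ latticeOf p) {j : Fin n} (h0 : ∀ i < j, u i = 0) :
    u j = 0 ∨ ∃ hjs : (j : ℕ) < s, p ⟨j, hjs⟩ j ∣ u j := by
  obtain ⟨c, hc⟩ : ∃ c : Fin s → ℤ, ∑ i, c i • p i = u := by
    rw [← Submodule.mem_span_range_iff_exists_fun, ← Submodule.mem_toAddSubgroup,
      Submodule.span_int_eq_addSubgroupClosure]
    exact hu
  have hcoord (l : Fin n) : u l = ∑ i, c i * p i l := by
    simp [← hc, Finset.sum_apply]
  have hzero : ∀ m (hm : m < s), m < j → c ⟨m, hm⟩ = 0 := by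
    intro m
    induction m using Nat.strong_induction_on with
    | _ m ih =>
      intro hm hmj
      have hl := hcoord ⟨m, hm.trans_le hsn⟩
      rw [h0 _ hmj, Finset.sum_eq_single ⟨m, hm⟩] at hl
      · exact (mul_eq_zero.1 hl.symm).resolve_right (hech2 ⟨m, hm⟩).ne'
      · intro b _ hb
        rcases lt_or_gt_of_ne (fun h => hb (Fin.ext h) : (b : ℕ) ≠ m) with h | h
        · rw [ih b h b.isLt (h.trans hmj), zero_mul]
        · rw [hech1 b _ h, mul_zero]
      · simp
  have hother (b : Fin s) (hb : (b : ℕ) ≠ j) : c b * p b j = 0 := by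
    rcases lt_or_gt_of_ne hb with h | h
    · rw [hzero b b.isLt h, zero_mul]
    · rw [hech1 b j h, mul_zero]
  by_cases hjs : (j : ℕ) < s
  · right
    refine ⟨hjs, ?_⟩
    rw [hcoord j, Finset.sum_eq_single ⟨j, hjs⟩ (fun b _ hb => hother b fun h => hb (Fin.ext h))
      (by simp)]
    exact dvd_mul_left _ _
  · left
    rw [hcoord j]
    exact Finset.sum_eq_zero fun b _ => hother b (by omega)

/-- Corollary 3.2: let `(z, z') ∈ K_{j+1}^+ ∪ K_{j+1}^-` with `‖z‖₁ = k + 1`, and, in case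
`j < s`, `|z'| < p_{j+1, j+1}`. If some `(v, v') ∈ 𝒢_{≤k}` satisfies `(v, v') ⊑_{j+1} (z, z')`,
then `(z, z')` is a positive-integer combination of elements of `𝒢_{≤k}` that are
`⊑_{j+1} (z, z')` (i.e. its normal form w.r.t. `𝒢_{≤k}` is `0`); otherwise
`(z, z') ∈ 𝒢_{k+1}`, i.e. it is irreducible. -/
theorem stmt4 (n s j : ℕ) (hs : 1 ≤ s) (hsn : s ≤ n) (hj : 1 ≤ j) (hjn : j + 1 ≤ n)
    (p : Fin s → Fin n → ℤ)
    (hech1 : ∀ (i : Fin s) (k : Fin n), (k : ℕ) < (i : ℕ) → p i k = 0)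
    (hech2 : ∀ i : Fin s, 0 < p i ⟨(i : ℕ), lt_of_lt_of_le i.isLt hsn⟩)
    (k : ℕ) (hk : 1 ≤ k)
    (z : (Fin j → ℤ) × ℤ)
    (hz : z ∈ KPairPlus n s j hjn p ∪ KPairMinus n s j hjn p)
    (hnorm : (∑ i, z.1 i) = (k : ℤ) + 1)
    (hbound : ∀ hjs : j < s, |z.2| < p ⟨j, hjs⟩ ⟨j, hjn⟩) :
    ((∃ v ∈ {g : (Fin j → ℤ) × ℤ |
          (IsIrred (KPairPlus n s j hjn p) g ∨ IsIrred (KPairMinus n s j hjn p) g) ∧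
          (∑ i, g.1 i) ≤ (k : ℤ)}, sqle v z) →
        IsNNCombP
          {g : (Fin j → ℤ) × ℤ |
            (IsIrred (KPairPlus n s j hjn p) g ∨ IsIrred (KPairMinus n s j hjn p) g) ∧
            (∑ i, g.1 i) ≤ (k : ℤ)}
          (fun g => sqle g z) z) ∧
    ((¬ ∃ v ∈ {g : (Fin j → ℤ) × ℤ |
          (IsIrred (KPairPlus n s j hjn p) g ∨ IsIrred (KPairMinus n s j hjn p) g) ∧
          (∑ i, g.1 i) ≤ (k : ℤ)}, sqle v z) →
        z ∈ {g : (Fin j → ℤ) × ℤ |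
          (IsIrred (KPairPlus n s j hjn p) g ∨ IsIrred (KPairMinus n s j hjn p) g) ∧
          (∑ i, g.1 i) = (k : ℤ) + 1}) := by
  set A := (latticeOf p).map (projPairHom n j hjn)
  have hplus : KPairPlus n s j hjn p = signedCone A 1 := by
    ext w
    simp only [signedCone, one_mul]
    rfl
  have hminus : KPairMinus n s j hjn p = signedCone A (-1) := by
    ext w
    simp only [signedCone, neg_mul, one_mul, Left.nonneg_neg_iff]
    rfl
  have hA : ∀ w ∈ A, w.1 = 0 → |w.2| ≤ |z.2| → w.2 = 0 := by
    rintro _ ⟨u, hu, rfl⟩ hw1 hle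
    rcases echelon_apply_of_forall_lt hsn hech1 hech2 hu (j := ⟨j, hjn⟩)
      (fun i hi => congrFun hw1 ⟨i, hi⟩) with h | ⟨hjs, hdvd⟩
    · exact h
    · exact Int.eq_zero_of_abs_lt_dvd hdvd (hle.trans_lt (hbound hjs))
  have hz0 : z ≠ 0 := by
    rintro rfl
    simp at hnorm
    omega
  rw [hplus, hminus] at hz ⊢
  obtain ⟨σ, hσ, hzσ, hirr⟩ : ∃ σ : ℤ, (σ = 1 ∨ σ = -1) ∧ z ∈ signedCone A σ ∧
      ∀ g, IsIrred (signedCone A σ) g →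
        IsIrred (signedCone A 1) g ∨ IsIrred (signedCone A (-1)) g := by
    rcases hz with hz | hz
    · exact ⟨1, Or.inl rfl, hz, fun g => Or.inl⟩
    · exact ⟨-1, Or.inr rfl, hz, fun g => Or.inr⟩
  constructor
  · rintro ⟨v, ⟨hv, hvk⟩, hvz⟩
    obtain ⟨hvA, hv0, hne⟩ : v ∈ A ∧ (∀ i, 0 ≤ v.1 i) ∧ v ≠ 0 := by
      rcases hv with hv | hv <;> exact ⟨hv.1.1, hv.1.2.1, hv.2.1⟩
    exact (isNNCombP_of_sqle hσ hA hzσ hnorm hvA hv0 hne hvk hvz).mono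
      fun a ha haz => ⟨⟨hirr a ha.1, ha.2⟩, haz⟩
  · intro h
    refine ⟨hirr z (isIrred_of_not_sqle hσ hA hzσ hz0 hnorm ?_), hnorm⟩
    rintro ⟨g, hg, hgk, hgz⟩
    exact h ⟨g, ⟨hirr g hg, hgk⟩, hgz⟩
end

section
/- Let k ∈ ℤ_{>0}. For each h ∈ H_j^+ let h' be the smallest nonnegative integer with (h, h') ∈ K_{j+1}, and let F := {(h, h') : h ∈ H_j^+} if j ≥ s, and F := {(h, h') : h ∈ H_j^+} ∪ {π_{j+1}(p_{j+1}), −π_{j+1}(p_{j+1})} if j < s. Assume F ⊆ 𝒢_{≤k} and 𝒢_{k+1} = 𝒢_{k+2} = ⋯ = 𝒢_{2k} = ∅. Then H_{j+1}^+ ∪ H_{j+1}^- = 𝒢_{≤k}; in particular every irreducible element (v, v') of K_{j+1}^+ ∪ K_{j+1}^- satisfies ‖v‖_1 ≤ k. -/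
/-- If `S` carries a positive additive grading, every element of `S` is a finite sum of
irreducible elements of `S`. -/
theorem exists_multiset_isIrred {α : Type*} [AddCommMonoid α] (S : Set α) (w : α → ℤ)
    (w_add : ∀ x y, w (x + y) = w x + w y) (w_pos : ∀ x ∈ S, x ≠ 0 → 0 < w x) {z : α}
    (hz : z ∈ S) : ∃ m : Multiset α, (∀ g ∈ m, IsIrred S g) ∧ m.sum = z := by
  induction hN : (w z).toNat using Nat.strong_induction_on generalizing z with
  | _ N ih =>
    subst hN
    by_cases h0 : z = 0
    · exact ⟨0, by simp, by simp [h0]⟩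
    by_cases hirr : IsIrred S z
    · exact ⟨{z}, by simpa using hirr, by simp⟩
    obtain ⟨x, hx, y, hy, hx0, hy0, rfl⟩ :
        ∃ x ∈ S, ∃ y ∈ S, x ≠ 0 ∧ y ≠ 0 ∧ z = x + y := by
      by_contra! hcon
      exact hirr ⟨hz, h0, hcon⟩
    have h1 := w_pos x hx hx0
    have h2 := w_pos y hy hy0
    have h3 := w_add x y
    obtain ⟨mx, hmx, rfl⟩ := ih _ (by omega) hx rfl
    obtain ⟨my, hmy, rfl⟩ := ih _ (by omega) hy rfl
    refine ⟨mx + my, fun g hg => ?_, by simp⟩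
    rcases Multiset.mem_add.mp hg with hg | hg
    exacts [hmx g hg, hmy g hg]

/-- An irreducible element that is a sum of nonzero elements of an additively closed set is one
of the summands. -/
theorem IsIrred.mem_of_multiset_sum {α : Type*} [AddCommMonoid α] {S : Set α}
    (zero_mem : (0 : α) ∈ S) (add_mem : ∀ x ∈ S, ∀ y ∈ S, x + y ∈ S) {m : Multiset α}
    (hm : ∀ g ∈ m, g ∈ S ∧ g ≠ 0) (hirr : IsIrred S m.sum) : m.sum ∈ m := by
  induction m using Multiset.induction with
  | empty => exact absurd rfl hirr.2.1
  | cons a m _ =>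
    have hsum : m.sum ∈ S := Multiset.sum_induction (· ∈ S) m (fun x y hx hy => add_mem x hx y hy)
      zero_mem fun g hg => (hm g (Multiset.mem_cons_of_mem hg)).1
    have ha := hm a (Multiset.mem_cons_self a m)
    by_cases h0 : m.sum = 0
    · simp [h0]
    · exact absurd (Multiset.sum_cons a m) (hirr.2.2 a ha.1 _ hsum ha.2 h0)

section Lattice

variable {n s j : ℕ} {p : Fin s → Fin n → ℤ}

theorem zero_mem_KPair (h : j + 1 ≤ n) : (0 : (Fin j → ℤ) × ℤ) ∈ KPair n s j h p :=
  ⟨0, (latticeOf p).zero_mem, rfl⟩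

theorem add_mem_KPair (h : j + 1 ≤ n) {x y : (Fin j → ℤ) × ℤ} (hx : x ∈ KPair n s j h p)
    (hy : y ∈ KPair n s j h p) : x + y ∈ KPair n s j h p := by
  obtain ⟨u, hu, rfl⟩ := hx
  obtain ⟨v, hv, rfl⟩ := hy
  exact ⟨u + v, (latticeOf p).add_mem hu hv, rfl⟩

theorem sub_mem_KPair (h : j + 1 ≤ n) {x y : (Fin j → ℤ) × ℤ} (hx : x ∈ KPair n s j h p)
    (hy : y ∈ KPair n s j h p) : x - y ∈ KPair n s j h p := by
  obtain ⟨u, hu, rfl⟩ := hx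
  obtain ⟨v, hv, rfl⟩ := hy
  exact ⟨u - v, (latticeOf p).sub_mem hu hv, rfl⟩

theorem fst_mem_KProj (h : j + 1 ≤ n) {x : (Fin j → ℤ) × ℤ} (hx : x ∈ KPair n s j h p) :
    x.1 ∈ KProj n s j (Nat.le_of_succ_le h) p := by
  obtain ⟨u, hu, rfl⟩ := hx
  exact ⟨u, hu, rfl⟩

theorem zero_mem_KPairPlus (h : j + 1 ≤ n) : (0 : (Fin j → ℤ) × ℤ) ∈ KPairPlus n s j h p :=
  ⟨zero_mem_KPair h, fun _ => le_rfl, le_rfl⟩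

theorem zero_mem_KPairMinus (h : j + 1 ≤ n) : (0 : (Fin j → ℤ) × ℤ) ∈ KPairMinus n s j h p :=
  ⟨zero_mem_KPair h, fun _ => le_rfl, le_rfl⟩

theorem add_mem_KPairPlus (h : j + 1 ≤ n) {x y : (Fin j → ℤ) × ℤ}
    (hx : x ∈ KPairPlus n s j h p) (hy : y ∈ KPairPlus n s j h p) :
    x + y ∈ KPairPlus n s j h p :=
  ⟨add_mem_KPair h hx.1 hy.1, fun i => add_nonneg (hx.2.1 i) (hy.2.1 i),
    add_nonneg hx.2.2 hy.2.2⟩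

theorem add_mem_KPairMinus (h : j + 1 ≤ n) {x y : (Fin j → ℤ) × ℤ}
    (hx : x ∈ KPairMinus n s j h p) (hy : y ∈ KPairMinus n s j h p) :
    x + y ∈ KPairMinus n s j h p :=
  ⟨add_mem_KPair h hx.1 hy.1, fun i => add_nonneg (hx.2.1 i) (hy.2.1 i),
    add_nonpos hx.2.2 hy.2.2⟩

theorem sum_pos_of_nonneg_of_ne_zero {v : Fin j → ℤ} (hv : ∀ i, 0 ≤ v i) (h0 : v ≠ 0) :
    0 < ∑ i, v i := by
  refine lt_of_le_of_ne (Finset.sum_nonneg fun i _ => hv i) fun h => h0 ?_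
  funext i
  exact (Finset.sum_eq_zero_iff_of_nonneg fun i _ => hv i).mp h.symm i (Finset.mem_univ i)

theorem exists_multiset_isIrred_KProjPlus (h : j ≤ n) {z : Fin j → ℤ}
    (hz : z ∈ KProjPlus n s j h p) :
    ∃ m : Multiset (Fin j → ℤ), (∀ g ∈ m, IsIrred (KProjPlus n s j h p) g) ∧ m.sum = z :=
  exists_multiset_isIrred _ (fun v => ∑ i, v i) (fun _ _ => Finset.sum_add_distrib ..)
    (fun x hx h0 => sum_pos_of_nonneg_of_ne_zero (v := x) hx.2 h0) hz

theorem exists_multiset_isIrred_KPairPlus (h : j + 1 ≤ n) {z : (Fin j → ℤ) × ℤ}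
    (hz : z ∈ KPairPlus n s j h p) :
    ∃ m : Multiset ((Fin j → ℤ) × ℤ), (∀ g ∈ m, IsIrred (KPairPlus n s j h p) g) ∧ m.sum = z := by
  refine exists_multiset_isIrred _ (fun v => (∑ i, v.1 i) + v.2) (fun x y => ?_)
    (fun x hx h0 => ?_) hz
  · simp only [Prod.fst_add, Prod.snd_add, Pi.add_apply, Finset.sum_add_distrib]
    ring
  · by_cases h1 : x.1 = 0
    · have h2 : x.2 ≠ 0 := fun h2 => h0 (Prod.ext h1 h2)
      have := hx.2.2
      simp only [h1, Pi.zero_apply, Finset.sum_const_zero]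
      omega
    · exact add_pos_of_pos_of_nonneg (sum_pos_of_nonneg_of_ne_zero hx.2.1 h1) hx.2.2

theorem exists_multiset_isIrred_KPairMinus (h : j + 1 ≤ n) {z : (Fin j → ℤ) × ℤ}
    (hz : z ∈ KPairMinus n s j h p) :
    ∃ m : Multiset ((Fin j → ℤ) × ℤ),
      (∀ g ∈ m, IsIrred (KPairMinus n s j h p) g) ∧ m.sum = z := by
  refine exists_multiset_isIrred _ (fun v => (∑ i, v.1 i) - v.2) (fun x y => ?_)
    (fun x hx h0 => ?_) hz
  · simp only [Prod.fst_add, Prod.snd_add, Pi.add_apply, Finset.sum_add_distrib]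
    ring
  · have h3 := hx.2.2
    by_cases h1 : x.1 = 0
    · have h2 : x.2 ≠ 0 := fun h2 => h0 (Prod.ext h1 h2)
      simp only [h1, Pi.zero_apply, Finset.sum_const_zero]
      omega
    · have := sum_pos_of_nonneg_of_ne_zero hx.2.1 h1
      omega

theorem exists_coeff_of_mem_latticeOf {x : Fin n → ℤ} (hx : x ∈ latticeOf p) :
    ∃ a : Fin s → ℤ, ∀ c, x c = ∑ i, a i * p i c := by
  induction hx using AddSubgroup.closure_induction with
  | mem x hx =>
    obtain ⟨i, rfl⟩ := hx
    exact ⟨Pi.single i 1, fun c => by simp [Pi.single_apply]⟩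
  | zero => exact ⟨0, by simp⟩
  | add x y _ _ hx hy =>
    obtain ⟨a, ha⟩ := hx
    obtain ⟨b, hb⟩ := hy
    exact ⟨a + b, fun c => by simp [ha, hb, add_mul, Finset.sum_add_distrib]⟩
  | neg x _ hx =>
    obtain ⟨a, ha⟩ := hx
    exact ⟨-a, fun c => by simp [ha]⟩

/-- A lattice vector whose first `j` coordinates vanish only involves the generators
from the `(j + 1)`-st on. -/
theorem coeff_eq_zero_of_echelon (hsn : s ≤ n)
    (hech1 : ∀ (i : Fin s) (c : Fin n), (c : ℕ) < (i : ℕ) → p i c = 0)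
    (hech2 : ∀ i : Fin s, 0 < p i ⟨(i : ℕ), lt_of_lt_of_le i.isLt hsn⟩) {a : Fin s → ℤ}
    (ha : ∀ c : Fin n, (c : ℕ) < j → ∑ i, a i * p i c = 0) (i : Fin s) (hi : (i : ℕ) < j) :
    a i = 0 := by
  induction hN : (i : ℕ) using Nat.strong_induction_on generalizing i with
  | _ N ih =>
    subst hN
    have h1 := ha ⟨i, lt_of_lt_of_le i.isLt hsn⟩ hi
    rw [Finset.sum_eq_single i] at h1
    · exact (mul_eq_zero.mp h1).resolve_right (hech2 i).ne'
    · intro l _ hl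
      rcases lt_or_gt_of_ne (Fin.val_ne_of_ne hl) with hl | hl
      · rw [ih l hl l (hl.trans hi) rfl, zero_mul]
      · rw [hech1 l _ hl, mul_zero]
    · simp

/-- The kernel of `K_{j+1} → K_j` consists of the multiples of `π_{j+1}(p_{j+1})`. -/
theorem exists_coeff_of_fst_eq_zero (hsn : s ≤ n) (hjn : j + 1 ≤ n)
    (hech1 : ∀ (i : Fin s) (c : Fin n), (c : ℕ) < (i : ℕ) → p i c = 0)
    (hech2 : ∀ i : Fin s, 0 < p i ⟨(i : ℕ), lt_of_lt_of_le i.isLt hsn⟩)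
    {z : (Fin j → ℤ) × ℤ} (hz : z ∈ KPair n s j hjn p) (hz0 : z.1 = 0) :
    (s ≤ j → z = 0) ∧ ∀ hjs : j < s, ∃ c : ℤ, z = c • projPair n j hjn (p ⟨j, hjs⟩) := by
  obtain ⟨x, hx, rfl⟩ := hz
  obtain ⟨a, ha⟩ := exists_coeff_of_mem_latticeOf hx
  have h0 : ∀ c : Fin n, (c : ℕ) < j → ∑ i, a i * p i c = 0 := fun c hc => by
    rw [← ha]
    exact congrFun hz0 ⟨c, hc⟩
  have hcoeff := coeff_eq_zero_of_echelon hsn hech1 hech2 h0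
  refine ⟨fun hsj => Prod.ext hz0 ?_, fun hjs => ⟨a ⟨j, hjs⟩, Prod.ext ?_ ?_⟩⟩
  · change x ⟨j, hjn⟩ = 0
    rw [ha]
    exact Finset.sum_eq_zero fun i _ => by rw [hcoeff i (i.isLt.trans_le hsj), zero_mul]
  · rw [hz0]
    funext i
    have : (projPair n j hjn (p ⟨j, hjs⟩)).1 i = 0 := hech1 _ _ i.isLt
    simp [this]
  · change x ⟨j, hjn⟩ = a ⟨j, hjs⟩ * p ⟨j, hjs⟩ ⟨j, hjn⟩
    rw [ha]
    refine Finset.sum_eq_single _ (fun l _ hl => ?_) (by simp)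
    rcases lt_or_gt_of_ne (Fin.val_ne_of_ne hl) with hl | hl
    · rw [hcoeff l hl, zero_mul]
    · rw [hech1 l _ hl, mul_zero]

/-- The elements of `𝒢_{≤ k}`. -/
def IsIrredLE (n s j : ℕ) (h : j + 1 ≤ n) (p : Fin s → Fin n → ℤ) (k : ℕ)
    (g : (Fin j → ℤ) × ℤ) : Prop :=
  (IsIrred (KPairPlus n s j h p) g ∨ IsIrred (KPairMinus n s j h p) g) ∧
    (∑ i, g.1 i) ≤ (k : ℤ)

theorem IsIrredLE.mem_KPair {h : j + 1 ≤ n} {k : ℕ} {g : (Fin j → ℤ) × ℤ}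
    (hg : IsIrredLE n s j h p k g) : g ∈ KPair n s j h p :=
  hg.1.elim (fun hg => hg.1.1) fun hg => hg.1.1

theorem IsIrredLE.fst_nonneg {h : j + 1 ≤ n} {k : ℕ} {g : (Fin j → ℤ) × ℤ}
    (hg : IsIrredLE n s j h p k g) : ∀ i, 0 ≤ g.1 i :=
  hg.1.elim (fun hg => hg.1.2.1) fun hg => hg.1.2.1

theorem IsIrredLE.ne_zero {h : j + 1 ≤ n} {k : ℕ} {g : (Fin j → ℤ) × ℤ}
    (hg : IsIrredLE n s j h p k g) : g ≠ 0 :=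
  hg.1.elim (fun hg => hg.2.1) fun hg => hg.2.1

/-- An element of `K_{j+1}` with nonnegative first part and norm at most `k` is a sum of elements
of `𝒢_{≤ k}` without cancellation in the last coordinate. -/
theorem exists_multiset_isIrredLE (h : j + 1 ≤ n) {k : ℕ} {z : (Fin j → ℤ) × ℤ}
    (hz : z ∈ KPair n s j h p) (hnn : ∀ i, 0 ≤ z.1 i) (hk : (∑ i, z.1 i) ≤ (k : ℤ)) :
    ∃ m : Multiset ((Fin j → ℤ) × ℤ), (∀ g ∈ m, IsIrredLE n s j h p k g) ∧ m.sum = z ∧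
      (m.map fun g => |g.2|).sum = |z.2| := by
  have norm_le : ∀ m : Multiset ((Fin j → ℤ) × ℤ), (∀ g ∈ m, ∀ i, 0 ≤ g.1 i) → m.sum = z →
      ∀ g ∈ m, (∑ i, g.1 i) ≤ (k : ℤ) := by
    rintro m hm rfl g hg
    refine le_trans (Finset.sum_le_sum fun i _ => ?_) hk
    obtain ⟨m, rfl⟩ := Multiset.exists_cons_of_mem hg
    have : ∀ i, 0 ≤ m.sum.1 i := Multiset.sum_induction (fun x => ∀ i, 0 ≤ x.1 i) m
      (fun x y hx hy i => add_nonneg (hx i) (hy i)) (fun _ => le_rfl)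
      fun x hx => hm x (Multiset.mem_cons_of_mem hx)
    simpa using this i
  have map_snd : ∀ m : Multiset ((Fin j → ℤ) × ℤ), m.sum = z →
      (m.map fun g => g.2).sum = z.2 := by
    rintro m rfl
    exact (map_multiset_sum (AddMonoidHom.snd (Fin j → ℤ) ℤ) m).symm
  rcases le_total 0 z.2 with h2 | h2
  · obtain ⟨m, hm, hsum⟩ := exists_multiset_isIrred_KPairPlus h ⟨hz, hnn, h2⟩
    refine ⟨m, fun g hg => ⟨.inl (hm g hg),
      norm_le m (fun g hg => (hm g hg).1.2.1) hsum g hg⟩, hsum, ?_⟩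
    rw [abs_of_nonneg h2, ← map_snd m hsum]
    exact congrArg _ (Multiset.map_congr rfl fun g hg => abs_of_nonneg (hm g hg).1.2.2)
  · obtain ⟨m, hm, hsum⟩ := exists_multiset_isIrred_KPairMinus h ⟨hz, hnn, h2⟩
    refine ⟨m, fun g hg => ⟨.inr (hm g hg),
      norm_le m (fun g hg => (hm g hg).1.2.1) hsum g hg⟩, hsum, ?_⟩
    rw [abs_of_nonpos h2, ← map_snd m hsum, ← Multiset.sum_map_neg]
    exact congrArg Multiset.sum (Multiset.map_congr rfl fun g hg => abs_of_nonpos (hm g hg).1.2.2)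

/-- If there are no irreducible elements of norm between `k + 1` and `2 * k`, sums of elements of
`𝒢_{≤ k}` can be rewritten so that all last coordinates have the same sign. -/
theorem exists_multiset_isIrredLE_same_sign (h : j + 1 ≤ n) {k : ℕ}
    (hgap : ∀ g, IsIrredLE n s j h p (2 * k) g → IsIrredLE n s j h p k g)
    (m : Multiset ((Fin j → ℤ) × ℤ)) (hm : ∀ g ∈ m, IsIrredLE n s j h p k g) :
    ∃ m' : Multiset ((Fin j → ℤ) × ℤ), (∀ g ∈ m', IsIrredLE n s j h p k g) ∧ m'.sum = m.sum ∧
      ((∀ g ∈ m', 0 ≤ g.2) ∨ ∀ g ∈ m', g.2 ≤ 0) := by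
  induction hN : ((m.map fun g : (Fin j → ℤ) × ℤ => |g.2|).sum).toNat using Nat.strong_induction_on
    generalizing m with
  | _ N ih =>
    subst hN
    by_cases hsign : (∀ g ∈ m, 0 ≤ g.2) ∨ ∀ g ∈ m, g.2 ≤ 0
    · exact ⟨m, hm, rfl, hsign⟩
    push Not at hsign
    obtain ⟨⟨a, ha, ha2⟩, b, hb, hb2⟩ := hsign
    obtain ⟨m, rfl⟩ := Multiset.exists_cons_of_mem ha
    have hb : b ∈ m := (Multiset.mem_cons.mp hb).resolve_left (by rintro rfl; omega)
    obtain ⟨m, rfl⟩ := Multiset.exists_cons_of_mem hb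
    have hga := hm a (by simp)
    have hgb := hm b (by simp)
    obtain ⟨r, hr, hrsum, hrabs⟩ := exists_multiset_isIrredLE h (k := 2 * k)
      (add_mem_KPair h hga.mem_KPair hgb.mem_KPair)
      (fun i => add_nonneg (hga.fst_nonneg i) (hgb.fst_nonneg i)) (by
        have h1 := hga.2
        have h2 := hgb.2
        simp only [Prod.fst_add, Pi.add_apply, Finset.sum_add_distrib]
        push_cast
        omega)
    have hmem : ∀ g ∈ r + m, IsIrredLE n s j h p k g := fun g hg => by
      rcases Multiset.mem_add.mp hg with hg | hg
      · exact hgap g (hr g hg)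
      · exact hm g (by simp [hg])
    have hlt : ((r + m).map fun g => |g.2|).sum < ((a ::ₘ b ::ₘ m).map fun g => |g.2|).sum := by
      simp only [Multiset.map_add, Multiset.sum_add, Multiset.map_cons, Multiset.sum_cons, hrabs,
        Prod.snd_add]
      have : |a.2 + b.2| < |a.2| + |b.2| := by
        rw [abs_of_neg ha2, abs_of_pos hb2, abs_lt]
        constructor <;> omega
      omega
    have hnonneg : 0 ≤ ((r + m).map fun g => |g.2|).sum :=
      Multiset.sum_nonneg fun x hx => by
        obtain ⟨g, _, rfl⟩ := Multiset.mem_map.mp hx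
        exact abs_nonneg _
    obtain ⟨m', hm', hsum', hsign'⟩ := ih _ (by omega) (r + m) hmem rfl
    refine ⟨m', hm', ?_, hsign'⟩
    rw [hsum', Multiset.sum_add, hrsum, Multiset.sum_cons, Multiset.sum_cons, add_assoc]

/-- If the elements of `K_{j+1}` with nonnegative first part are sums of elements of `𝒢_{≤ k}`
and there is a norm gap between `k + 1` and `2 * k`, all irreducible elements lie in `𝒢_{≤ k}`. -/
theorem isIrredLE_of_isIrred (h : j + 1 ≤ n) {k : ℕ}
    (hgap : ∀ g, IsIrredLE n s j h p (2 * k) g → IsIrredLE n s j h p k g)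
    {z : (Fin j → ℤ) × ℤ} {m : Multiset ((Fin j → ℤ) × ℤ)}
    (hm : ∀ g ∈ m, IsIrredLE n s j h p k g) (hsum : m.sum = z)
    (hz : IsIrred (KPairPlus n s j h p) z ∨ IsIrred (KPairMinus n s j h p) z) :
    IsIrredLE n s j h p k z := by
  obtain ⟨m, hm, hsum', hsign⟩ := exists_multiset_isIrredLE_same_sign h hgap m hm
  obtain rfl := hsum'.trans hsum
  clear hsum hsum'
  have snd_sum : m.sum.2 = (m.map fun g => g.2).sum :=
    map_multiset_sum (AddMonoidHom.snd (Fin j → ℤ) ℤ) m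
  refine hm _ ?_
  rcases hz with hz | hz
  · refine hz.mem_of_multiset_sum (zero_mem_KPairPlus h)
      (fun x hx y hy => add_mem_KPairPlus h hx hy) fun g hg =>
        ⟨⟨(hm g hg).mem_KPair, (hm g hg).fst_nonneg, ?_⟩, (hm g hg).ne_zero⟩
    rcases hsign with hsign | hsign
    · exact hsign g hg
    · by_contra! hneg
      have hpos := hz.1.2.2
      obtain ⟨m, rfl⟩ := Multiset.exists_cons_of_mem hg
      rw [snd_sum, Multiset.map_cons, Multiset.sum_cons] at hpos
      have : (m.map fun g => g.2).sum ≤ 0 := Multiset.sum_induction (· ≤ 0) _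
        (fun _ _ => add_nonpos) le_rfl (by
          simp only [Multiset.mem_map]
          rintro _ ⟨x, hx, rfl⟩
          exact hsign x (Multiset.mem_cons_of_mem hx))
      omega
  · refine hz.mem_of_multiset_sum (zero_mem_KPairMinus h)
      (fun x hx y hy => add_mem_KPairMinus h hx hy) fun g hg =>
        ⟨⟨(hm g hg).mem_KPair, (hm g hg).fst_nonneg, ?_⟩, (hm g hg).ne_zero⟩
    rcases hsign with hsign | hsign
    · by_contra! hpos
      have hneg := hz.1.2.2
      obtain ⟨m, rfl⟩ := Multiset.exists_cons_of_mem hg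
      rw [snd_sum, Multiset.map_cons, Multiset.sum_cons] at hneg
      have : 0 ≤ (m.map fun g => g.2).sum := Multiset.sum_induction (0 ≤ ·) _
        (fun _ _ => add_nonneg) le_rfl (by
          simp only [Multiset.mem_map]
          rintro _ ⟨x, hx, rfl⟩
          exact hsign x (Multiset.mem_cons_of_mem hx))
      omega
    · exact hsign g hg

end Lattice

/-- Lemma 3.3: let `k ≥ 1`, let `F` be the input set built from `H_j^+` (using for each
`h ∈ H_j^+` the smallest nonnegative lift `h'` with `(h, h') ∈ K_{j+1}`, and adding
`±π_{j+1}(p_{j+1})` when `j < s`). If `F ⊆ 𝒢_{≤k}` and `𝒢_{k+1} = ⋯ = 𝒢_{2k} = ∅`, then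
`H_{j+1}^+ ∪ H_{j+1}^- = 𝒢_{≤k}`, i.e. every irreducible element has norm at most `k`. -/
theorem stmt5 (n s j : ℕ) (hs : 1 ≤ s) (hsn : s ≤ n) (hj : 1 ≤ j) (hjn : j + 1 ≤ n)
    (p : Fin s → Fin n → ℤ)
    (hech1 : ∀ (i : Fin s) (k : Fin n), (k : ℕ) < (i : ℕ) → p i k = 0)
    (hech2 : ∀ i : Fin s, 0 < p i ⟨(i : ℕ), lt_of_lt_of_le i.isLt hsn⟩)
    (k : ℕ) (hk : 1 ≤ k)
    (h' : (Fin j → ℤ) → ℤ)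
    (hh' : ∀ h, IsIrred (KProjPlus n s j (Nat.le_of_succ_le hjn) p) h →
      0 ≤ h' h ∧ (h, h' h) ∈ KPair n s j hjn p ∧
      ∀ m : ℤ, 0 ≤ m → (h, m) ∈ KPair n s j hjn p → h' h ≤ m)
    (F : Set ((Fin j → ℤ) × ℤ))
    (hF1 : s ≤ j →
      F = (fun h => (h, h' h)) '' {h | IsIrred (KProjPlus n s j (Nat.le_of_succ_le hjn) p) h})
    (hF2 : ∀ hjs : j < s,
      F = (fun h => (h, h' h)) '' {h | IsIrred (KProjPlus n s j (Nat.le_of_succ_le hjn) p) h} ∪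
          {projPair n j hjn (p ⟨j, hjs⟩), -projPair n j hjn (p ⟨j, hjs⟩)})
    (hFsub : F ⊆ {g : (Fin j → ℤ) × ℤ |
        (IsIrred (KPairPlus n s j hjn p) g ∨ IsIrred (KPairMinus n s j hjn p) g) ∧
        (∑ i, g.1 i) ≤ (k : ℤ)})
    (hempty : ∀ m : ℕ, k + 1 ≤ m → m ≤ 2 * k →
      {g : (Fin j → ℤ) × ℤ |
        (IsIrred (KPairPlus n s j hjn p) g ∨ IsIrred (KPairMinus n s j hjn p) g) ∧
        (∑ i, g.1 i) = (m : ℤ)} = ∅) :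
    {g : (Fin j → ℤ) × ℤ |
        IsIrred (KPairPlus n s j hjn p) g ∨ IsIrred (KPairMinus n s j hjn p) g} =
      {g : (Fin j → ℤ) × ℤ |
        (IsIrred (KPairPlus n s j hjn p) g ∨ IsIrred (KPairMinus n s j hjn p) g) ∧
        (∑ i, g.1 i) ≤ (k : ℤ)} := by
  have hgap : ∀ g, IsIrredLE n s j hjn p (2 * k) g → IsIrredLE n s j hjn p k g := by
    intro g hg
    refine ⟨hg.1, ?_⟩
    by_contra! hlt
    have hle := hg.2
    push_cast at hle
    refine (Set.eq_empty_iff_forall_notMem.mp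
      (hempty (∑ i, g.1 i).toNat (by omega) (by omega)) g) ⟨hg.1, by omega⟩
  have hlift : ∀ h, IsIrred (KProjPlus n s j (Nat.le_of_succ_le hjn) p) h → (h, h' h) ∈ F := by
    intro h hh
    rcases le_or_gt s j with hsj | hjs
    · rw [hF1 hsj]
      exact ⟨h, hh, rfl⟩
    · rw [hF2 hjs]
      exact .inl ⟨h, hh, rfl⟩
  have hker : ∀ z ∈ KPair n s j hjn p, z.1 = 0 →
      ∃ m : Multiset ((Fin j → ℤ) × ℤ), (∀ g ∈ m, g ∈ F) ∧ m.sum = z := by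
    intro z hz hz0
    obtain ⟨h1, h2⟩ := exists_coeff_of_fst_eq_zero hsn hjn hech1 hech2 hz hz0
    rcases le_or_gt s j with hsj | hjs
    · exact ⟨0, by simp, by simp [h1 hsj]⟩
    obtain ⟨c, rfl⟩ := h2 hjs
    obtain ⟨c, rfl | rfl⟩ := c.eq_nat_or_neg
    · refine ⟨Multiset.replicate c (projPair n j hjn (p ⟨j, hjs⟩)), fun g hg => ?_, by simp⟩
      rw [Multiset.eq_of_mem_replicate hg, hF2 hjs]
      exact .inr (.inl rfl)
    · refine ⟨Multiset.replicate c (-projPair n j hjn (p ⟨j, hjs⟩)), fun g hg => ?_, by simp⟩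
      rw [Multiset.eq_of_mem_replicate hg, hF2 hjs]
      exact .inr (.inr rfl)
  have hgen : ∀ z ∈ KPair n s j hjn p, (∀ i, 0 ≤ z.1 i) →
      ∃ m : Multiset ((Fin j → ℤ) × ℤ), (∀ g ∈ m, g ∈ F) ∧ m.sum = z := by
    intro z hz hnn
    obtain ⟨m, hm, hsum⟩ := exists_multiset_isIrred_KProjPlus (Nat.le_of_succ_le hjn)
      (z := z.1) ⟨fst_mem_KProj hjn hz, hnn⟩
    set l := m.map fun h => (h, h' h) with hl
    have hlF : ∀ g ∈ l, g ∈ F := by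
      simp only [hl, Multiset.mem_map]
      rintro _ ⟨x, hx, rfl⟩
      exact hlift x (hm x hx)
    have hl1 : l.sum.1 = z.1 := by
      have := map_multiset_sum (AddMonoidHom.fst (Fin j → ℤ) ℤ) l
      simpa [hl, hsum] using this
    have hlK : l.sum ∈ KPair n s j hjn p := Multiset.sum_induction (· ∈ KPair n s j hjn p) l
      (fun _ _ => add_mem_KPair hjn) (zero_mem_KPair hjn)
      fun g hg => IsIrredLE.mem_KPair (hFsub (hlF g hg))
    obtain ⟨r, hr, hrsum⟩ := hker _ (sub_mem_KPair hjn hz hlK) (by simp [hl1])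
    refine ⟨l + r, fun g hg => ?_, by rw [Multiset.sum_add, hrsum, add_sub_cancel]⟩
    rcases Multiset.mem_add.mp hg with hg | hg
    exacts [hlF g hg, hr g hg]
  ext z
  refine ⟨fun hz => ?_, fun hz => hz.1⟩
  obtain ⟨m, hm, hsum⟩ := hgen z (hz.elim (fun hz => hz.1.1) fun hz => hz.1.1)
    (hz.elim (fun hz => hz.1.2.1) fun hz => hz.1.2.1)
  exact isIrredLE_of_isIrred hjn hgap (fun g hg => hFsub (hm g hg)) hsum hz
end

section
/- Let G ⊆ K̄_{j+1}^+ ∪ K̄_{j+1}^- be a finite set such that: (i) every element of K̄_{j+1}^+ ∪ K̄_{j+1}^- is a finite nonnegative-real combination of elements of G; and (ii) for all (v, v'), (w, w') ∈ G with v'·w' < 0, the vector (v − (v'/w')w, 0) can be written as a finite nonnegative-real combination of elements (u, u') ∈ G with supp((u, u')) ⊆ supp((v − (v'/w')w, 0)). Then for every extreme element z of K̄_{j+1}^+ and every extreme element z of K̄_{j+1}^-, the set G contains a positive scalar multiple of z. -/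
/-- The real linear span `L ⊆ ℝ^n` of the integer vectors `p_1, …, p_s`. -/
def spanR {n s : ℕ} (p : Fin s → Fin n → ℤ) : Set (Fin n → ℝ) :=
  (Submodule.span ℝ (Set.range fun i => fun k : Fin n => (p i k : ℝ)) : Submodule ℝ (Fin n → ℝ))

/-- `K̄_j := π_j(L)`. -/
def KRProj (n s j : ℕ) (h : j ≤ n) (p : Fin s → Fin n → ℤ) : Set (Fin j → ℝ) :=
  proj n j h '' spanR p

/-- `K̄_j^+`: the elements of `K̄_j` with all coordinates nonnegative. -/
def KRProjPlus (n s j : ℕ) (h : j ≤ n) (p : Fin s → Fin n → ℤ) : Set (Fin j → ℝ) :=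
  {z ∈ KRProj n s j h p | ∀ i, 0 ≤ z i}

/-- `K̄_{j+1} := π_{j+1}(L)`, in pair form. -/
def KRPair (n s j : ℕ) (h : j + 1 ≤ n) (p : Fin s → Fin n → ℤ) : Set ((Fin j → ℝ) × ℝ) :=
  projPair n j h '' spanR p

/-- `K̄_{j+1}^+`: first `j` coordinates nonnegative and last coordinate nonnegative. -/
def KRPairPlus (n s j : ℕ) (h : j + 1 ≤ n) (p : Fin s → Fin n → ℤ) : Set ((Fin j → ℝ) × ℝ) :=
  {z ∈ KRPair n s j h p | (∀ i, 0 ≤ z.1 i) ∧ 0 ≤ z.2}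

/-- `K̄_{j+1}^-`: first `j` coordinates nonnegative and last coordinate nonpositive. -/
def KRPairMinus (n s j : ℕ) (h : j + 1 ≤ n) (p : Fin s → Fin n → ℤ) : Set ((Fin j → ℝ) × ℝ) :=
  {z ∈ KRPair n s j h p | (∀ i, 0 ≤ z.1 i) ∧ z.2 ≤ 0}

/-- `z` is a finite nonnegative-real combination of elements of `F`. -/
def IsNNRComb {α : Type*} [AddCommMonoid α] [Module ℝ α] (F : Set α) (z : α) : Prop :=
  ∃ c : α →₀ ℝ, ↑c.support ⊆ F ∧ (∀ a, 0 ≤ c a) ∧ z = c.sum fun a r => r • a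

/-- `z` is a finite nonnegative-real combination of elements of `F`, all of which satisfy
the predicate `P`. -/
def IsNNRCombP {α : Type*} [AddCommMonoid α] [Module ℝ α] (F : Set α) (P : α → Prop)
    (z : α) : Prop :=
  ∃ c : α →₀ ℝ, ↑c.support ⊆ F ∧ (∀ a, 0 ≤ c a) ∧ (∀ a ∈ c.support, P a) ∧
    z = c.sum fun a r => r • a

/-- `z` is an extreme element (spans an extreme ray) of the convex cone `C`:
`z` is a nonzero element of `C` and whenever `z = x + y` with `x, y ∈ C`, both `x` and `y`
are nonnegative scalar multiples of `z`. -/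
def IsExtremeIn {α : Type*} [AddCommMonoid α] [Module ℝ α] (C : Set α) (z : α) : Prop :=
  z ∈ C ∧ z ≠ 0 ∧ ∀ x ∈ C, ∀ y ∈ C, z = x + y →
    (∃ t : ℝ, 0 ≤ t ∧ x = t • z) ∧ (∃ t : ℝ, 0 ≤ t ∧ y = t • z)

/-- `supp u ⊆ supp v` for pairs. -/
def suppSubset {j : ℕ} (u v : (Fin j → ℝ) × ℝ) : Prop :=
  (∀ i, v.1 i = 0 → u.1 i = 0) ∧ (v.2 = 0 → u.2 = 0)

open scoped NNReal

section ConicHull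

variable {E : Type*} [AddCommMonoid E] [Module ℝ E]

theorem IsNNRComb.mem_span {F : Set E} {z : E} (h : IsNNRComb F z) :
    z ∈ Submodule.span ℝ≥0 F := by
  obtain ⟨c, hc, h0, rfl⟩ := h
  refine Submodule.sum_mem _ fun a ha => ?_
  exact Submodule.smul_mem _ (⟨c a, h0 a⟩ : ℝ≥0) (Submodule.subset_span (hc ha))

theorem IsNNRCombP.isNNRComb_sep {F : Set E} {P : E → Prop} {z : E} (h : IsNNRCombP F P z) :
    IsNNRComb {x ∈ F | P x} z := by
  obtain ⟨c, hc, h0, hP, hz⟩ := h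
  exact ⟨c, fun a ha => ⟨hc ha, hP a ha⟩, h0, hz⟩

/-- An extreme element of a cone is, up to a positive scalar, one of the generators in any
nonnegative combination of elements of the cone. -/
theorem IsExtremeIn.exists_pos_smul_mem {C G : Set E} {z : E} (hz : IsExtremeIn C z)
    (hadd : ∀ x ∈ C, ∀ y ∈ C, x + y ∈ C) (hsmul : ∀ r : ℝ≥0, ∀ x ∈ C, r • x ∈ C)
    (hGC : G ⊆ C) (hzG : z ∈ Submodule.span ℝ≥0 G) : ∃ t : ℝ, 0 < t ∧ t • z ∈ G := by
  have hzero : (0 : E) ∈ C := by simpa using hsmul 0 z hz.1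
  have hspan : ∀ x ∈ Submodule.span ℝ≥0 G, x ∈ C := fun x hx => by
    induction hx using Submodule.span_induction with
    | mem x hx => exact hGC hx
    | zero => exact hzero
    | add x y _ _ hx hy => exact hadd x hx y hy
    | smul r x _ hx => exact hsmul r x hx
  have key : ∀ x ∈ Submodule.span ℝ≥0 G, ∀ r : ℝ≥0, ∀ y ∈ C, r • x + y = z →
      r • x = 0 ∨ ∃ t : ℝ, 0 < t ∧ t • z ∈ G := fun x hx => by
    induction hx using Submodule.span_induction with
    | zero => simp
    | mem x hx =>
      intro r y hy h
      rcases eq_or_ne r 0 with rfl | hr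
      · simp
      obtain ⟨⟨t, ht, htx⟩, -⟩ := hz.2.2 (r • x) (hsmul r x (hGC hx)) y hy h.symm
      rcases ht.eq_or_lt with rfl | ht
      · left; rw [htx, zero_smul]
      right
      have hr' : (0 : ℝ) < r := by exact_mod_cast pos_iff_ne_zero.2 hr
      refine ⟨(r : ℝ)⁻¹ * t, by positivity, ?_⟩
      rwa [mul_smul, ← htx, NNReal.smul_def, inv_smul_smul₀ hr'.ne']
    | add x₁ x₂ hx₁ hx₂ ih₁ ih₂ =>
      intro r y hy h
      rcases ih₁ r (r • x₂ + y) (hadd _ (hsmul _ _ (hspan _ hx₂)) _ hy)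
        (by rw [← h, smul_add, add_assoc]) with h₁ | h₁
      · rcases ih₂ r (r • x₁ + y) (hadd _ (hsmul _ _ (hspan _ hx₁)) _ hy)
          (by rw [← h, smul_add]; abel) with h₂ | h₂
        · left; rw [smul_add, h₁, h₂, add_zero]
        · exact .inr h₂
      · exact .inr h₁
    | smul c x _ ih =>
      intro r y hy h
      rw [← mul_smul] at h ⊢
      exact ih (r * c) y hy h
  rcases key z hzG 1 0 hzero (by simp) with h | h
  · exact absurd (by simpa using h) hz.2.1
  · exact h

/-- The pairs of generators on opposite sides of the hyperplane `f = 0` cancel inside the cone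
generated by the generators on that hyperplane. -/
def CancelsAcross (f : E →ₗ[ℝ] ℝ) (G : Set E) : Prop :=
  ∀ v ∈ G, ∀ w ∈ G, 0 < f v → f w < 0 →
    (-f w) • v + f v • w ∈ Submodule.span ℝ≥0 {x ∈ G | f x = 0}

theorem CancelsAcross.neg {f : E →ₗ[ℝ] ℝ} {G : Set E} (h : CancelsAcross f G) :
    CancelsAcross (-f) G := by
  intro v hv w hw hfv hfw
  simp only [LinearMap.neg_apply, neg_neg, neg_eq_zero, Left.neg_pos_iff, Left.neg_neg_iff]
    at hfv hfw ⊢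
  rw [add_comm]
  exact h w hw v hv hfw hfv

theorem CancelsAcross.smul_add_mem {f : E →ₗ[ℝ] ℝ} {G : Set E} (h : CancelsAcross f G)
    {g : E} (hg : g ∈ G) (hfg : 0 < f g) {y : E}
    (hy : y ∈ Submodule.span ℝ≥0 {x ∈ G | f x ≤ 0}) (r : ℝ≥0) :
    r • g + y ∈ Submodule.span ℝ≥0 {x ∈ G | f x ≤ 0} ∨
      ∃ r' : ℝ≥0, ∃ u ∈ Submodule.span ℝ≥0 {x ∈ G | f x = 0}, r • g + y = r' • g + u := by
  have hle : Submodule.span ℝ≥0 {x ∈ G | f x = 0} ≤ Submodule.span ℝ≥0 {x ∈ G | f x ≤ 0} :=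
    Submodule.span_mono fun x hx => ⟨hx.1, hx.2.le⟩
  induction hy using Submodule.span_induction generalizing r with
  | zero => exact .inr ⟨r, 0, Submodule.zero_mem _, rfl⟩
  | mem w hw =>
    rcases hw.2.eq_or_lt with hw0 | hwneg
    · exact .inr ⟨r, w, Submodule.subset_span ⟨hw.1, hw0⟩, rfl⟩
    have ht := h g hg w hw.1 hfg hwneg
    obtain ⟨a, ha⟩ : ∃ a : ℝ≥0, (a : ℝ) = f g := ⟨⟨_, hfg.le⟩, rfl⟩
    obtain ⟨b, hb⟩ : ∃ b : ℝ≥0, (b : ℝ) = -f w := ⟨⟨_, (neg_pos.2 hwneg).le⟩, rfl⟩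
    have ha0 : a ≠ 0 := by rintro rfl; simp at ha; linarith
    have hb0 : b ≠ 0 := by rintro rfl; simp at hb; linarith
    rw [← ha, ← hb, ← NNReal.smul_def, ← NNReal.smul_def] at ht
    rcases le_total b (r * a) with hba | hba
    · obtain ⟨d, hd⟩ := exists_add_of_le hba
      refine .inr ⟨a⁻¹ * d, _, Submodule.smul_mem _ a⁻¹ ht, ?_⟩
      have hr : r = a⁻¹ * d + a⁻¹ * b := by
        rw [← mul_add, add_comm d, ← hd]; field_simp
      rw [smul_add, ← mul_smul, ← mul_smul, inv_mul_cancel₀ ha0, one_smul, ← add_assoc,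
        ← add_smul, ← hr]
    · obtain ⟨d, hd⟩ := exists_add_of_le hba
      left
      have hsum : b⁻¹ * r * a + b⁻¹ * d = 1 := by
        rw [mul_assoc, ← mul_add, ← hd, inv_mul_cancel₀ hb0]
      have hrw : r • g + w = (b⁻¹ * r) • (b • g + a • w) + (b⁻¹ * d) • w := by
        rw [smul_add, ← mul_smul, ← mul_smul, add_assoc, ← add_smul, hsum, one_smul,
          mul_right_comm, inv_mul_cancel₀ hb0, one_mul]
      rw [hrw]
      exact add_mem (Submodule.smul_mem _ _ (hle ht))
        (Submodule.smul_mem _ _ (Submodule.subset_span hw))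
  | add y₁ y₂ _ hy₂ ih₁ ih₂ =>
    rcases ih₁ r with h₁ | ⟨r', u, hu, h₁⟩
    · left; rw [← add_assoc]; exact add_mem h₁ hy₂
    rcases ih₂ r' with h₂ | ⟨r'', u', hu', h₂⟩
    · left; rw [← add_assoc, h₁, add_right_comm]; exact add_mem h₂ (hle hu)
    · exact .inr ⟨r'', u' + u, add_mem hu' hu, by
        rw [← add_assoc, h₁, add_right_comm, h₂, add_assoc]⟩
  | smul c y _ ih =>
    rcases eq_or_ne c 0 with rfl | hc
    · exact .inr ⟨r, 0, Submodule.zero_mem _, by simp⟩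
    have hrw : r • g + c • y = c • ((c⁻¹ * r) • g + y) := by
      rw [smul_add, ← mul_smul, mul_inv_cancel_left₀ hc]
    rcases ih (c⁻¹ * r) with h₁ | ⟨r', u, hu, h₁⟩
    · left; rw [hrw]; exact Submodule.smul_mem _ _ h₁
    · exact .inr ⟨c * r', c • u, Submodule.smul_mem _ _ hu, by
        rw [hrw, h₁, smul_add, ← mul_smul]⟩

theorem CancelsAcross.add_mem_or {f : E →ₗ[ℝ] ℝ} {G : Set E} (h : CancelsAcross f G)
    {g y : E} (hg : g ∈ G) (hfg : 0 ≤ f g)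
    (hy : y ∈ Submodule.span ℝ≥0 {x ∈ G | 0 ≤ f x} ∨
      y ∈ Submodule.span ℝ≥0 {x ∈ G | f x ≤ 0}) :
    g + y ∈ Submodule.span ℝ≥0 {x ∈ G | 0 ≤ f x} ∨
      g + y ∈ Submodule.span ℝ≥0 {x ∈ G | f x ≤ 0} := by
  have hg' : g ∈ Submodule.span ℝ≥0 {x ∈ G | 0 ≤ f x} := Submodule.subset_span ⟨hg, hfg⟩
  rcases hy with hy | hy
  · exact .inl (add_mem hg' hy)
  rcases hfg.eq_or_lt with h0 | hpos
  · exact .inr (add_mem (Submodule.subset_span ⟨hg, h0.ge⟩) hy)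
  rcases h.smul_add_mem hg hpos hy 1 with h₁ | ⟨r, u, hu, h₁⟩
  · right; simpa using h₁
  · left
    rw [one_smul] at h₁
    rw [h₁]
    exact add_mem (Submodule.smul_mem _ _ hg')
      (Submodule.span_mono (Set.inter_subset_inter_right G fun _ hx => hx.ge) hu)

/-- If opposite generators cancel across `f = 0`, then every element of the cone is generated by
the generators on one side of that hyperplane. -/
theorem CancelsAcross.mem_span_or {f : E →ₗ[ℝ] ℝ} {G : Set E} (h : CancelsAcross f G)
    {z : E} (hz : z ∈ Submodule.span ℝ≥0 G) :
    z ∈ Submodule.span ℝ≥0 {x ∈ G | 0 ≤ f x} ∨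
      z ∈ Submodule.span ℝ≥0 {x ∈ G | f x ≤ 0} := by
  suffices key : ∀ y, (y ∈ Submodule.span ℝ≥0 {x ∈ G | 0 ≤ f x} ∨
      y ∈ Submodule.span ℝ≥0 {x ∈ G | f x ≤ 0}) →
      (z + y ∈ Submodule.span ℝ≥0 {x ∈ G | 0 ≤ f x} ∨
      z + y ∈ Submodule.span ℝ≥0 {x ∈ G | f x ≤ 0}) by
    simpa using key 0 (.inl (Submodule.zero_mem _))
  induction hz using Submodule.span_induction with
  | zero => simp
  | mem g hg =>
    intro y hy
    rcases le_total 0 (f g) with hfg | hfg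
    · exact h.add_mem_or hg hfg hy
    · have := h.neg.add_mem_or (y := y) hg (by simpa using hfg) (by simpa using hy.symm)
      simpa using this.symm
  | add z₁ z₂ _ _ ih₁ ih₂ =>
    intro y hy
    rw [add_assoc]
    exact ih₁ _ (ih₂ _ hy)
  | smul c z _ ih =>
    intro y hy
    rcases eq_or_ne c 0 with rfl | hc
    · simpa using hy
    have hrw : c • z + y = c • (z + c⁻¹ • y) := by rw [smul_add, smul_inv_smul₀ hc]
    rw [hrw]
    exact (ih (c⁻¹ • y) (hy.imp (Submodule.smul_mem _ _) (Submodule.smul_mem _ _))).imp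
      (Submodule.smul_mem _ _) (Submodule.smul_mem _ _)

theorem nonpos_of_mem_span {f : E →ₗ[ℝ] ℝ} {G : Set E} {z : E}
    (hz : z ∈ Submodule.span ℝ≥0 {x ∈ G | f x ≤ 0}) : f z ≤ 0 := by
  induction hz using Submodule.span_induction with
  | zero => simp
  | mem x hx => exact hx.2
  | add x y _ _ hx hy => rw [map_add]; exact add_nonpos hx hy
  | smul c x _ hx =>
    rw [NNReal.smul_def, map_smul]
    exact mul_nonpos_of_nonneg_of_nonpos c.2 hx

theorem mem_span_zero_of_nonneg {f : E →ₗ[ℝ] ℝ} {G : Set E} {z : E}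
    (hz : z ∈ Submodule.span ℝ≥0 {x ∈ G | f x ≤ 0}) (hfz : 0 ≤ f z) :
    z ∈ Submodule.span ℝ≥0 {x ∈ G | f x = 0} := by
  induction hz using Submodule.span_induction with
  | zero => exact Submodule.zero_mem _
  | mem x hx => exact Submodule.subset_span ⟨hx.1, le_antisymm hx.2 hfz⟩
  | add x y hx hy ihx ihy =>
    have h₁ := nonpos_of_mem_span hx
    have h₂ := nonpos_of_mem_span hy
    rw [map_add] at hfz
    exact add_mem (ihx (by linarith)) (ihy (by linarith))
  | smul c x _ ih =>
    rcases eq_or_ne c 0 with rfl | hc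
    · simp
    have hc' : (0 : ℝ) < c := by exact_mod_cast pos_iff_ne_zero.2 hc
    rw [NNReal.smul_def, map_smul] at hfz
    exact Submodule.smul_mem _ _ (ih (nonneg_of_mul_nonneg_right hfz hc'))

theorem CancelsAcross.mem_span_nonneg {f : E →ₗ[ℝ] ℝ} {G : Set E} (h : CancelsAcross f G)
    {z : E} (hz : z ∈ Submodule.span ℝ≥0 G) (hfz : 0 ≤ f z) :
    z ∈ Submodule.span ℝ≥0 {x ∈ G | 0 ≤ f x} :=
  (h.mem_span_or hz).elim id fun h' =>
    Submodule.span_mono (Set.inter_subset_inter_right G fun _ hx => hx.ge) (mem_span_zero_of_nonneg h' hfz)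

end ConicHull

theorem KRPair_add_mem {n s j : ℕ} {h : j + 1 ≤ n} {p : Fin s → Fin n → ℤ}
    {x y : (Fin j → ℝ) × ℝ} (hx : x ∈ KRPair n s j h p) (hy : y ∈ KRPair n s j h p) :
    x + y ∈ KRPair n s j h p := by
  obtain ⟨a, ha, rfl⟩ := hx
  obtain ⟨b, hb, rfl⟩ := hy
  exact ⟨a + b, Submodule.add_mem _ ha hb, rfl⟩

theorem KRPair_smul_mem {n s j : ℕ} {h : j + 1 ≤ n} {p : Fin s → Fin n → ℤ} (r : ℝ)
    {x : (Fin j → ℝ) × ℝ} (hx : x ∈ KRPair n s j h p) : r • x ∈ KRPair n s j h p := by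
  obtain ⟨a, ha, rfl⟩ := hx
  exact ⟨r • a, Submodule.smul_mem _ r ha, rfl⟩

theorem KRPairPlus_add_mem {n s j : ℕ} {h : j + 1 ≤ n} {p : Fin s → Fin n → ℤ} :
    ∀ x ∈ KRPairPlus n s j h p, ∀ y ∈ KRPairPlus n s j h p, x + y ∈ KRPairPlus n s j h p :=
  fun _ hx _ hy => ⟨KRPair_add_mem hx.1 hy.1,
    fun i => add_nonneg (hx.2.1 i) (hy.2.1 i), add_nonneg hx.2.2 hy.2.2⟩

theorem KRPairPlus_smul_mem {n s j : ℕ} {h : j + 1 ≤ n} {p : Fin s → Fin n → ℤ} :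
    ∀ r : ℝ≥0, ∀ x ∈ KRPairPlus n s j h p, r • x ∈ KRPairPlus n s j h p :=
  fun r _ hx => ⟨KRPair_smul_mem (r : ℝ) hx.1,
    fun i => mul_nonneg r.2 (hx.2.1 i), mul_nonneg r.2 hx.2.2⟩

theorem KRPairMinus_add_mem {n s j : ℕ} {h : j + 1 ≤ n} {p : Fin s → Fin n → ℤ} :
    ∀ x ∈ KRPairMinus n s j h p, ∀ y ∈ KRPairMinus n s j h p, x + y ∈ KRPairMinus n s j h p :=
  fun _ hx _ hy => ⟨KRPair_add_mem hx.1 hy.1,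
    fun i => add_nonneg (hx.2.1 i) (hy.2.1 i), add_nonpos hx.2.2 hy.2.2⟩

theorem KRPairMinus_smul_mem {n s j : ℕ} {h : j + 1 ≤ n} {p : Fin s → Fin n → ℤ} :
    ∀ r : ℝ≥0, ∀ x ∈ KRPairMinus n s j h p, r • x ∈ KRPairMinus n s j h p :=
  fun r _ hx => ⟨KRPair_smul_mem (r : ℝ) hx.1,
    fun i => mul_nonneg r.2 (hx.2.1 i), mul_nonpos_of_nonneg_of_nonpos r.2 hx.2.2⟩

/-- Lemma 4.3 (correctness of the completion procedure for extreme rays): if the finite set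
`G ⊆ K̄_{j+1}^+ ∪ K̄_{j+1}^-` generates `K̄_{j+1}^+ ∪ K̄_{j+1}^-` over `ℝ_+`, and every S-vector
`(v - (v'/w')·w, 0)` of two elements `(v, v'), (w, w') ∈ G` with `v'·w' < 0` reduces to `0`
with respect to `G` (i.e. is a nonnegative-real combination of elements of `G` whose support is
contained in its support), then `G` contains a positive scalar multiple of every extreme element
of `K̄_{j+1}^+` and of `K̄_{j+1}^-`. -/
theorem stmt7 (n s j : ℕ) (hs : 1 ≤ s) (hsn : s ≤ n) (hj : 1 ≤ j) (hjn : j + 1 ≤ n)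
    (p : Fin s → Fin n → ℤ)
    (hech1 : ∀ (i : Fin s) (k : Fin n), (k : ℕ) < (i : ℕ) → p i k = 0)
    (hech2 : ∀ i : Fin s, 0 < p i ⟨(i : ℕ), lt_of_lt_of_le i.isLt hsn⟩)
    (G : Set ((Fin j → ℝ) × ℝ)) (hGfin : G.Finite)
    (hGsub : G ⊆ KRPairPlus n s j hjn p ∪ KRPairMinus n s j hjn p)
    (hGgen : ∀ z ∈ KRPairPlus n s j hjn p ∪ KRPairMinus n s j hjn p, IsNNRComb G z)
    (hS : ∀ v ∈ G, ∀ w ∈ G, v.2 * w.2 < 0 →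
      IsNNRCombP G (fun u => suppSubset u (v.1 - (v.2 / w.2) • w.1, (0 : ℝ)))
        (v.1 - (v.2 / w.2) • w.1, (0 : ℝ))) :
    ∀ z : (Fin j → ℝ) × ℝ,
      (IsExtremeIn (KRPairPlus n s j hjn p) z ∨ IsExtremeIn (KRPairMinus n s j hjn p) z) →
      ∃ t : ℝ, 0 < t ∧ t • z ∈ G := by
  have hC : CancelsAcross (LinearMap.snd ℝ (Fin j → ℝ) ℝ) G := by
    intro v hv w hw hfv hfw
    simp only [LinearMap.snd_apply] at hfv hfw ⊢
    have hmem := (hS v hv w hw (mul_neg_of_pos_of_neg hfv hfw)).isNNRComb_sep.mem_span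
    have hmem' : (v.1 - (v.2 / w.2) • w.1, (0 : ℝ)) ∈ Submodule.span ℝ≥0 {x ∈ G | x.2 = 0} :=
      Submodule.span_mono (Set.inter_subset_inter_right G fun _ hx => hx.2 rfl) hmem
    obtain ⟨b, hb⟩ : ∃ b : ℝ≥0, (b : ℝ) = -w.2 := ⟨⟨_, (neg_pos.2 hfw).le⟩, rfl⟩
    have heq : (-w.2) • v + v.2 • w = b • (v.1 - (v.2 / w.2) • w.1, (0 : ℝ)) := by
      have hw0 := hfw.ne
      rw [NNReal.smul_def, hb]
      ext i
      · simp
        field_simp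
        ring
      · simp
        ring
    rw [heq]
    exact Submodule.smul_mem _ b hmem'
  rintro z (hz | hz)
  · have hzG := (hGgen z (.inl hz.1)).mem_span
    obtain ⟨t, ht, htz⟩ := hz.exists_pos_smul_mem KRPairPlus_add_mem KRPairPlus_smul_mem
      (G := {x ∈ G | 0 ≤ x.2})
      (fun x hx => (hGsub hx.1).elim id fun h => ⟨h.1, h.2.1, hx.2⟩)
      (hC.mem_span_nonneg hzG hz.1.2.2)
    exact ⟨t, ht, htz.1⟩
  · have hzG := (hGgen z (.inr hz.1)).mem_span
    obtain ⟨t, ht, htz⟩ := hz.exists_pos_smul_mem KRPairMinus_add_mem KRPairMinus_smul_mem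
      (G := {x ∈ G | x.2 ≤ 0})
      (fun x hx => (hGsub hx.1).elim (fun h => ⟨h.1, h.2.1, hx.2⟩) id)
      (by simpa using hC.neg.mem_span_nonneg hzG (by simpa using hz.1.2.2))
    exact ⟨t, ht, htz.1⟩
end

section
/- Let A ∈ ℤ^{d×n}, b ∈ ℤ^d, c ∈ ℝ^n, and let z_0 ∈ {0,1}^n satisfy A z_0 = b. Let A' be the matrix obtained from A by negating the i-th column for every i with z_0^{(i)} = 1, and let c' be obtained from c by negating the i-th entry for every i with z_0^{(i)} = 1. Then there exists z ∈ {0,1}^n with A z = b and c^⊤ z < c^⊤ z_0 if and only if there exists v ∈ ℤ^n with 0 ≤ v ≤ 1 componentwise, A' v = 0, c'^⊤ v < 0, and v irreducible in the monoid ker_ℤ(A') ∩ ℤ_{≥0}^n. -/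
/-- Below every nonnegative integral kernel vector with negative objective value there is an
irreducible one with negative objective value. -/
lemma exists_isIrred_le_of_sum_neg {d n : ℕ} (A : Matrix (Fin d) (Fin n) ℤ) (c : Fin n → ℝ)
    (v : Fin n → ℤ) (hAv : A.mulVec v = 0) (hv : ∀ i, 0 ≤ v i)
    (hc : (∑ i, c i * (v i : ℝ)) < 0) :
    ∃ u : Fin n → ℤ, (∀ i, u i ≤ v i) ∧ (∑ i, c i * (u i : ℝ)) < 0 ∧
      IsIrred {w : Fin n → ℤ | A.mulVec w = 0 ∧ ∀ i, 0 ≤ w i} u := by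
  have sum_pos {w : Fin n → ℤ} (hw : ∀ i, 0 ≤ w i) (hne : w ≠ 0) : 0 < ∑ i, w i :=
    Fintype.sum_pos (lt_of_le_of_ne hw hne.symm)
  induction hN : (∑ i, v i).toNat using Nat.strong_induction_on generalizing v with
  | _ N ih =>
    by_cases hirr : IsIrred {w : Fin n → ℤ | A.mulVec w = 0 ∧ ∀ i, 0 ≤ w i} v
    · exact ⟨v, fun _ => le_rfl, hc, hirr⟩
    have hv0 : v ≠ 0 := by
      rintro rfl
      simp at hc
    have hdec : ∃ x : Fin n → ℤ, (A.mulVec x = 0 ∧ ∀ i, 0 ≤ x i) ∧ ∃ y : Fin n → ℤ,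
        (A.mulVec y = 0 ∧ ∀ i, 0 ≤ y i) ∧ x ≠ 0 ∧ y ≠ 0 ∧ v = x + y := by
      by_contra! h
      exact hirr ⟨⟨hAv, hv⟩, hv0, h⟩
    obtain ⟨x, ⟨hAx, hx⟩, y, ⟨hAy, hy⟩, hx0, hy0, rfl⟩ := hdec
    have hxs := sum_pos hx hx0
    have hys := sum_pos hy hy0
    simp only [Pi.add_apply, Finset.sum_add_distrib] at hN
    have hsplit : (∑ i, c i * (x i : ℝ)) + ∑ i, c i * (y i : ℝ) < 0 := by
      rw [← Finset.sum_add_distrib]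
      simpa [mul_add] using hc
    rcases lt_or_ge (∑ i, c i * (x i : ℝ)) 0 with hcx | hcx
    · obtain ⟨u, hu, h⟩ := ih _ (by omega) x hAx hx hcx rfl
      exact ⟨u, fun i => (hu i).trans (le_add_of_nonneg_right (hy i)), h⟩
    · obtain ⟨u, hu, h⟩ := ih _ (by omega) y hAy hy (by linarith) rfl
      exact ⟨u, fun i => (hu i).trans (le_add_of_nonneg_left (hx i)), h⟩

/-- Improving a feasible 0-1 solution via a truncated Hilbert basis: given a 0-1 solution `z₀`
of `Az = b`, after flipping the coordinates where `z₀` equals `1` (negating the corresponding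
columns of `A` and entries of `c`), there is a cheaper 0-1 solution if and only if there is an
element `v ≤ 1` of the truncated Hilbert basis of `ker_ℤ(A') ∩ ℤ_{≥0}^n` with strictly negative
transformed objective value `c'ᵀ v`. -/
theorem stmt11 (d n : ℕ) (A : Matrix (Fin d) (Fin n) ℤ) (b : Fin d → ℤ) (c : Fin n → ℝ)
    (z₀ : Fin n → ℤ) (hz₀01 : ∀ i, z₀ i = 0 ∨ z₀ i = 1) (hz₀ : A.mulVec z₀ = b)
    (A' : Matrix (Fin d) (Fin n) ℤ)
    (hA' : ∀ k i, A' k i = if z₀ i = 1 then -A k i else A k i)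
    (c' : Fin n → ℝ)
    (hc' : ∀ i, c' i = if z₀ i = 1 then -c i else c i) :
    (∃ z : Fin n → ℤ, (∀ i, z i = 0 ∨ z i = 1) ∧ A.mulVec z = b ∧
        (∑ i, c i * (z i : ℝ)) < ∑ i, c i * (z₀ i : ℝ)) ↔
      (∃ v : Fin n → ℤ, (∀ i, 0 ≤ v i ∧ v i ≤ 1) ∧ A'.mulVec v = 0 ∧
        (∑ i, c' i * (v i : ℝ)) < 0 ∧
        IsIrred {w : Fin n → ℤ | A'.mulVec w = 0 ∧ ∀ i, 0 ≤ w i} v) := by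
  have flip_mulVec (z v : Fin n → ℤ) (h : ∀ i, z i = z₀ i + (1 - 2 * z₀ i) * v i) :
      A.mulVec z = b + A'.mulVec v := by
    rw [← hz₀]
    ext k
    simp only [Matrix.mulVec, dotProduct, Pi.add_apply, ← Finset.sum_add_distrib]
    refine Finset.sum_congr rfl fun i _ => ?_
    rw [h i, hA' k i]
    rcases hz₀01 i with hi | hi
    · simp [hi]
    · simp [hi]
      ring
  have flip_cost (z v : Fin n → ℤ) (h : ∀ i, z i = z₀ i + (1 - 2 * z₀ i) * v i) :
      (∑ i, c i * (z i : ℝ)) = (∑ i, c i * (z₀ i : ℝ)) + ∑ i, c' i * (v i : ℝ) := by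
    rw [← Finset.sum_add_distrib]
    refine Finset.sum_congr rfl fun i _ => ?_
    rw [h i, hc' i]
    rcases hz₀01 i with hi | hi
    · simp [hi]
    · simp [hi]
      ring
  constructor
  · rintro ⟨z, hz01, hz, hcz⟩
    let v : Fin n → ℤ := fun i => (1 - 2 * z₀ i) * (z i - z₀ i)
    have hzv (i) : z i = z₀ i + (1 - 2 * z₀ i) * v i := by
      rcases hz₀01 i with hi | hi <;> simp [v, hi]
    have hv (i) : 0 ≤ v i ∧ v i ≤ 1 := by
      rcases hz₀01 i with hi | hi <;> rcases hz01 i with hi' | hi' <;> simp [v, hi, hi']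
    have hAv : A'.mulVec v = 0 := by simpa [hz] using flip_mulVec z v hzv
    have hcv : (∑ i, c' i * (v i : ℝ)) < 0 := by linarith [flip_cost z v hzv]
    obtain ⟨u, huv, hcu, hu⟩ :=
      exists_isIrred_le_of_sum_neg A' c' v hAv (fun i => (hv i).1) hcv
    exact ⟨u, fun i => ⟨hu.1.2 i, (huv i).trans (hv i).2⟩, hu.1.1, hcu, hu⟩
  · rintro ⟨v, hv, hAv, hcv, -⟩
    let z : Fin n → ℤ := fun i => z₀ i + (1 - 2 * z₀ i) * v i
    refine ⟨z, fun i => ?_, ?_, ?_⟩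
    · have := hv i
      rcases hz₀01 i with hi | hi <;> simp only [z, hi] <;> omega
    · simpa [hAv] using flip_mulVec z v fun _ => rfl
    · linarith [flip_cost z v fun _ => rfl]
end
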